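/- arXiv:2108.01551 — 2 statements merged into one kernel-verified Lean document; each statement's English description precedes it below -/
import Mathlib

section
/- Let n = 1 and assume f : ℝ × D × [0,ε₀] → ℝ satisfies conditions A.1–A.3 and is T-periodic in t, where D ⊆ ℝ is open. Let a < b with [a,b] ⊂ D, suppose f₁(a)·f₁(b) < 0, and suppose there exists z* ∈ (a,b) such that f₁(z*) = 0 and f₁(z) ≠ 0 for all z ∈ [a,b] \ {z*}. Then there exist ε_V ∈ (0,ε₀] and, for each ε ∈ [0,ε_V], a T-periodic solution φ(·,ε) of x′ = ε f(t,x,ε) with values in (a,b), such that φ(·,ε) converges uniformly to the constant z* as ε → 0. -/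
open MeasureTheory Set
open Filter Topology

/-- Carathéodory conditions on the real line, with a single integrable bound `g`. -/
structure IsCaratheodory (F : ℝ → ℝ → ℝ) (g : ℝ → ℝ) : Prop where
  continuous : ∀ᵐ s, Continuous (F s)
  measurable : ∀ x, AEStronglyMeasurable (fun s => F s x) volume
  integrable_bound : Integrable g
  bound : ∀ᵐ s, ∀ x, |F s x| ≤ g s

namespace IsCaratheodory

variable {F : ℝ → ℝ → ℝ} {g : ℝ → ℝ}

theorem aestronglyMeasurable_simpleFunc (hF : IsCaratheodory F g) (y : SimpleFunc ℝ ℝ) :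
    AEStronglyMeasurable (fun s => F s (y s)) volume := by
  have hU : (⋃ r : y.range, y ⁻¹' {(r : ℝ)}) = univ := by
    ext s
    simp
  rw [← Measure.restrict_univ (μ := (volume : Measure ℝ)), ← hU, aestronglyMeasurable_iUnion_iff]
  intro r
  refine ((hF.measurable r).restrict).congr ?_
  filter_upwards [ae_restrict_mem (y.measurableSet_fiber r)] with s hs
  rw [show y s = r from hs]

theorem aestronglyMeasurable (hF : IsCaratheodory F g) {y : ℝ → ℝ} (hy : Measurable y) :
    AEStronglyMeasurable (fun s => F s (y s)) volume := by
  have hys := hy.stronglyMeasurable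
  refine aestronglyMeasurable_of_tendsto_ae atTop
    (fun n => hF.aestronglyMeasurable_simpleFunc (hys.approx n)) ?_
  filter_upwards [hF.continuous] with s hs
  exact (hs.tendsto _).comp (hys.tendsto_approx s)

theorem integrable (hF : IsCaratheodory F g) {y : ℝ → ℝ} (hy : Measurable y) :
    Integrable (fun s => F s (y s)) := by
  refine hF.integrable_bound.mono' (hF.aestronglyMeasurable hy) ?_
  filter_upwards [hF.bound] with s hs using hs _

theorem bound_nonneg (hF : IsCaratheodory F g) : 0 ≤ᵐ[volume] g := by
  filter_upwards [hF.bound] with s hs using (abs_nonneg _).trans (hs 0)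

theorem tendsto_integral (hF : IsCaratheodory F g) {ι : Type*} {l : Filter ι}
    [l.IsCountablyGenerated] {y : ι → ℝ → ℝ} {y₀ : ℝ → ℝ} (hy : ∀ i, Measurable (y i))
    (hlim : ∀ s, Tendsto (fun i => y i s) l (𝓝 (y₀ s))) (u v : ℝ) :
    Tendsto (fun i => ∫ s in u..v, F s (y i s)) l (𝓝 (∫ s in u..v, F s (y₀ s))) := by
  refine intervalIntegral.tendsto_integral_filter_of_dominated_convergence g
    (Eventually.of_forall fun i => (hF.aestronglyMeasurable (hy i)).restrict)
    (Eventually.of_forall fun i => ?_) hF.integrable_bound.intervalIntegrable ?_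
  · filter_upwards [hF.bound] with s hs _ using hs _
  · filter_upwards [hF.continuous] with s hs _
    exact (hs.tendsto _).comp (hlim s)

theorem abs_integral_le (hF : IsCaratheodory F g) (y : ℝ → ℝ) (u v : ℝ) :
    |∫ s in u..v, F s (y s)| ≤ |∫ s in u..v, g s| :=
  intervalIntegral.norm_integral_le_abs_of_norm_le (f := fun s => F s (y s))
    (by filter_upwards [ae_restrict_of_ae hF.bound] with s hs using hs _)
    hF.integrable_bound.intervalIntegrable

theorem abs_integral_bound_le (hF : IsCaratheodory F g) (u v : ℝ) :
    |∫ s in u..v, g s| ≤ ∫ s, g s := by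
  rw [intervalIntegral.abs_intervalIntegral_eq, abs_of_nonneg
    (integral_nonneg_of_ae (ae_restrict_of_ae hF.bound_nonneg))]
  exact setIntegral_le_integral hF.integrable_bound hF.bound_nonneg

end IsCaratheodory

/-- Iterates of Tonelli's delayed integral equation `x t = z + ∫₀ᵗ F s (x (s - h))`. -/
noncomputable def tonelliIterate (F : ℝ → ℝ → ℝ) (h z : ℝ) : ℕ → ℝ → ℝ
  | 0 => fun _ => z
  | n + 1 => fun t => z + ∫ s in (0:ℝ)..t, F s (tonelliIterate F h z n (max (s - h) 0))

namespace IsCaratheodory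

variable {F : ℝ → ℝ → ℝ} {g : ℝ → ℝ}

theorem continuous_tonelliIterate (hF : IsCaratheodory F g) (h z : ℝ) (n : ℕ) :
    Continuous (tonelliIterate F h z n) := by
  induction n with
  | zero => exact continuous_const
  | succ n ih =>
    have hm : Continuous fun s => tonelliIterate F h z n (max (s - h) 0) := by fun_prop
    have hi : ∀ u v, IntervalIntegrable
        (fun s => F s (tonelliIterate F h z n (max (s - h) 0))) volume u v :=
      fun _ _ => (hF.integrable hm.measurable).intervalIntegrable
    exact continuous_const.add (intervalIntegral.continuous_primitive hi 0)

theorem continuous_tonelliIterate_initial (hF : IsCaratheodory F g) (h : ℝ) (n : ℕ) (t : ℝ) :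
    Continuous fun z => tonelliIterate F h z n t := by
  induction n generalizing t with
  | zero => exact continuous_id
  | succ n ih =>
    refine continuous_id.add (continuous_iff_continuousAt.2 fun z₀ => ?_)
    refine hF.tendsto_integral (fun z => ?_) (fun s => (ih _).tendsto z₀) 0 t
    exact ((hF.continuous_tonelliIterate h z n).comp (by fun_prop)).measurable

end IsCaratheodory

theorem tonelliIterate_succ_eq (F : ℝ → ℝ → ℝ) {h : ℝ} (hh : 0 ≤ h) (z : ℝ) (n : ℕ) {t : ℝ}
    (ht₀ : 0 ≤ t) (ht : t ≤ n * h) :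
    tonelliIterate F h z (n + 1) t = tonelliIterate F h z n t := by
  induction n generalizing t with
  | zero =>
    obtain rfl : t = 0 := le_antisymm (by simpa using ht) ht₀
    simp [tonelliIterate]
  | succ n ih =>
    change z + ∫ s in (0:ℝ)..t, F s (tonelliIterate F h z (n + 1) (max (s - h) 0)) =
      z + ∫ s in (0:ℝ)..t, F s (tonelliIterate F h z n (max (s - h) 0))
    congr 1
    refine intervalIntegral.integral_congr fun s hs => ?_
    rw [uIcc_of_le ht₀] at hs
    have hn : (0:ℝ) ≤ n * h := by positivity
    push_cast at ht
    rw [ih (le_max_right _ _) (max_le (by linarith [hs.2]) hn)]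

/-- Arzelà–Ascoli for a family of real functions with a common modulus of continuity. -/
theorem isCompact_setOf_abs_sub_le {G : ℝ → ℝ} (hG : Continuous G) (α β : ℝ) :
    IsCompact {x : C(ℝ, ℝ) | x 0 ∈ Icc α β ∧ ∀ s t, |x t - x s| ≤ |G t - G s|} := by
  have hcont : ∀ x : ℝ → ℝ, (∀ s t, |x t - x s| ≤ |G t - G s|) → Continuous x := by
    intro x hx
    refine continuous_iff_continuousAt.2 fun s => tendsto_iff_dist_tendsto_zero.2 ?_
    exact squeeze_zero (fun _ => dist_nonneg) (fun t => hx s t)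
      (tendsto_iff_dist_tendsto_zero.1 (hG.tendsto s))
  apply ArzelaAscoli.isCompact_of_equicontinuous
  · have himage : Set.image ContinuousMap.toFun
        {x : C(ℝ, ℝ) | x 0 ∈ Icc α β ∧ ∀ s t, |x t - x s| ≤ |G t - G s|} =
        {x : ℝ → ℝ | x 0 ∈ Icc α β ∧ ∀ s t, |x t - x s| ≤ |G t - G s|} := by
      ext x
      constructor
      · rintro ⟨y, hy, rfl⟩
        exact hy
      · intro hx
        exact ⟨⟨x, hcont x hx.2⟩, hx, rfl⟩
    rw [himage]
    refine (isCompact_univ_pi fun t : ℝ =>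
      isCompact_Icc (a := α - |G t - G 0|) (b := β + |G t - G 0|)).of_isClosed_subset ?_ ?_
    · have hmod : IsClosed {x : ℝ → ℝ | ∀ s t, |x t - x s| ≤ |G t - G s|} := by
        rw [show {x : ℝ → ℝ | ∀ s t, |x t - x s| ≤ |G t - G s|} =
          ⋂ s, ⋂ t, {x : ℝ → ℝ | |x t - x s| ≤ |G t - G s|} by ext; simp]
        exact isClosed_iInter fun s => isClosed_iInter fun t =>
          isClosed_le (by fun_prop) continuous_const
      exact (isClosed_Icc.preimage (continuous_apply 0)).inter hmod
    · rintro x ⟨h0, hx⟩ t -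
      have := abs_le.1 (hx 0 t)
      exact ⟨by linarith [h0.1], by linarith [h0.2]⟩
  · intro s
    rw [Metric.equicontinuousAt_iff]
    intro ε hε
    obtain ⟨δ, hδ, h⟩ := Metric.continuous_iff.1 hG s ε hε
    refine ⟨δ, hδ, fun t ht x => ?_⟩
    rw [dist_comm]
    exact (x.2.2 s t).trans_lt (h t ht)

/-- If the delayed approximations of `x' = F t x` push the two ends of `[α, β]` in opposite
directions over `[0, T]`, then some solution starting in `[α, β]` returns to its initial value. -/
theorem IsCaratheodory.exists_periodic {F : ℝ → ℝ → ℝ} {g : ℝ → ℝ} (hF : IsCaratheodory F g)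
    {T α β σ : ℝ} (hT : 0 < T) (hαβ : α ≤ β)
    (hα : ∀ y : ℝ → ℝ, Continuous y → (∀ s, |y s - α| ≤ ∫ s, g s) →
      0 < σ * ∫ s in (0:ℝ)..T, F s (y s))
    (hβ : ∀ y : ℝ → ℝ, Continuous y → (∀ s, |y s - β| ≤ ∫ s, g s) →
      σ * ∫ s in (0:ℝ)..T, F s (y s) < 0) :
    ∃ x : ℝ → ℝ, Continuous x ∧ x 0 ∈ Icc α β ∧ (∀ t, |x t - x 0| ≤ ∫ s, g s) ∧ x T = x 0 ∧
      ∀ t ∈ Icc 0 T, x t = x 0 + ∫ s in (0:ℝ)..t, F s (x s) := by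
  have hGi : ∀ u v, IntervalIntegrable g volume u v :=
    fun _ _ => hF.integrable_bound.intervalIntegrable
  set G : ℝ → ℝ := fun t => ∫ s in (0:ℝ)..t, g s
  have hG : Continuous G := intervalIntegral.continuous_primitive hGi 0
  have hGsub : ∀ s t, G t - G s = ∫ r in s..t, g r := fun s t =>
    intervalIntegral.integral_interval_sub_left (hGi _ _) (hGi _ _)
  have hint : ∀ {y : ℝ → ℝ}, Continuous y → ∀ u v,
      IntervalIntegrable (fun s => F s (y s)) volume u v :=
    fun hy _ _ => (hF.integrable hy.measurable).intervalIntegrable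
  have hiter : ∀ h z n s t, |tonelliIterate F h z n t - tonelliIterate F h z n s|
      ≤ |G t - G s| := by
    intro h z n s t
    cases n with
    | zero => simp [tonelliIterate]
    | succ n =>
      have hc : Continuous fun s => tonelliIterate F h z n (max (s - h) 0) :=
        (hF.continuous_tonelliIterate h z n).comp (by fun_prop)
      rw [tonelliIterate, add_sub_add_left_eq_sub,
        intervalIntegral.integral_interval_sub_left (hint hc _ _) (hint hc _ _), hGsub]
      exact hF.abs_integral_le _ _ _
  have hzero : ∀ h z n, tonelliIterate F h z n 0 = z := by
    intro h z n
    cases n <;> simp [tonelliIterate]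
  have hdev : ∀ h z n t, |tonelliIterate F h z n t - z| ≤ ∫ s, g s := by
    intro h z n t
    have := hiter h z n 0 t
    rw [hzero, hGsub] at this
    exact this.trans (hF.abs_integral_bound_le _ _)
  have hσ : σ ≠ 0 := by
    rintro rfl
    have := hα (fun _ => α) continuous_const
      (fun s => by simpa using integral_nonneg_of_ae hF.bound_nonneg)
    simp at this
  set h : ℕ → ℝ := fun k => T / (k + 1 : ℕ) with hhdef
  have hh : ∀ k, 0 ≤ h k := fun k => by positivity
  have hhk : ∀ k, ((k + 1 : ℕ) : ℝ) * h k = T := fun k => by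
    simp only [hhdef]
    field_simp
  have hshoot : ∀ k : ℕ, ∃ z ∈ Icc α β,
      ∫ s in (0:ℝ)..T, F s (tonelliIterate F (h k) z (k + 1) (max (s - h k) 0)) = 0 := by
    intro k
    have hc : ∀ z, Continuous fun s => tonelliIterate F (h k) z (k + 1) (max (s - h k) 0) :=
      fun z => (hF.continuous_tonelliIterate (h k) z _).comp (by fun_prop)
    have hcont : Continuous fun z =>
        σ * ∫ s in (0:ℝ)..T, F s (tonelliIterate F (h k) z (k + 1) (max (s - h k) 0)) := by
      refine continuous_const.mul (continuous_iff_continuousAt.2 fun z₀ => ?_)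
      exact hF.tendsto_integral (fun z => (hc z).measurable)
        (fun s => (hF.continuous_tonelliIterate_initial (h k) (k + 1) _).tendsto z₀) 0 T
    obtain ⟨z, hz, hz0⟩ := intermediate_value_Icc' hαβ hcont.continuousOn
      ⟨(hβ _ (hc β) fun s => hdev _ _ _ _).le, (hα _ (hc α) fun s => hdev _ _ _ _).le⟩
    exact ⟨z, hz, (mul_eq_zero.1 hz0).resolve_left hσ⟩
  choose z hz hz0 using hshoot
  set X : ℕ → C(ℝ, ℝ) := fun k =>
    ⟨tonelliIterate F (h k) (z k) (k + 1), hF.continuous_tonelliIterate _ _ _⟩ with hX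
  have hXeq : ∀ k, ∀ t ∈ Icc 0 T, X k t = z k + ∫ s in (0:ℝ)..t, F s (X k (max (s - h k) 0)) :=
    fun k t ht => (tonelliIterate_succ_eq F (hh k) (z k) (k + 1) ht.1
      (ht.2.trans_eq (hhk k).symm)).symm
  have hX0 : ∀ k, X k 0 = z k := fun k => hzero _ _ _
  obtain ⟨x, ⟨hx0, hxG⟩, ψ, hψ, hlim⟩ := (isCompact_setOf_abs_sub_le hG α β).tendsto_subseq
    (x := X) fun k => ⟨by rw [hX0]; exact hz k, hiter _ _ _⟩
  have hh0 : Tendsto (fun k => h (ψ k)) atTop (𝓝 0) :=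
    ((tendsto_const_div_atTop_nhds_zero_nat T).comp (tendsto_add_atTop_nat 1)).comp
      hψ.tendsto_atTop
  have hpt : ∀ t, Tendsto (fun k => X (ψ k) t) atTop (𝓝 (x t)) := fun t =>
    ((continuous_eval_const t).tendsto x).comp hlim
  have hdelay : ∀ s, Tendsto (fun k => X (ψ k) (max (s - h (ψ k)) 0)) atTop
      (𝓝 (x (max s 0))) := by
    intro s
    have h1 : Tendsto (fun k => max (s - h (ψ k)) 0) atTop (𝓝 (max s 0)) := by
      simpa using (tendsto_const_nhds.sub hh0).max (tendsto_const_nhds (x := (0:ℝ)))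
    exact (continuous_eval.tendsto (x, max s 0)).comp (hlim.prodMk_nhds h1)
  have hsol : ∀ t ∈ Icc 0 T, x t = x 0 + ∫ s in (0:ℝ)..t, F s (x s) := by
    intro t ht
    have h1 : Tendsto (fun k => X (ψ k) t) atTop
        (𝓝 (x 0 + ∫ s in (0:ℝ)..t, F s (x (max s 0)))) := by
      have := (hpt 0).add (hF.tendsto_integral (l := atTop)
        (fun k => ((X (ψ k)).continuous.comp (by fun_prop)).measurable) hdelay 0 t)
      refine this.congr fun k => ?_
      rw [hXeq _ t ht, hX0]
      rfl
    rw [tendsto_nhds_unique (hpt t) h1]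
    congr 1
    refine intervalIntegral.integral_congr fun s hs => ?_
    rw [uIcc_of_le ht.1] at hs
    simp only [max_eq_left hs.1]
  refine ⟨x, x.continuous, hx0, fun t => ?_, ?_, hsol⟩
  · refine (hxG 0 t).trans ?_
    rw [hGsub]
    exact hF.abs_integral_bound_le _ _
  · refine tendsto_nhds_unique (hpt T) ((hpt 0).congr fun k => ?_)
    rw [hXeq _ T ⟨hT.le, le_rfl⟩, hX0]
    have := hz0 (ψ k)
    simp only [hX, ContinuousMap.coe_mk]
    rw [this, add_zero]

theorem IsCaratheodory.const_mul {F : ℝ → ℝ → ℝ} {g : ℝ → ℝ} (hF : IsCaratheodory F g) {c : ℝ}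
    (hc : 0 ≤ c) : IsCaratheodory (fun s x => c * F s x) (fun s => c * g s) where
  continuous := by
    filter_upwards [hF.continuous] with s hs using continuous_const.mul hs
  measurable x := (hF.measurable x).const_mul c
  integrable_bound := hF.integrable_bound.const_mul c
  bound := by
    filter_upwards [hF.bound] with s hs x
    rw [abs_mul, abs_of_nonneg hc]
    exact mul_le_mul_of_nonneg_left (hs x) hc

section Family

variable {H : ℝ → ℝ → ℝ → ℝ} {g : ℝ → ℝ} {ε₀ T : ℝ}

theorem eventually_mul_integral_pos (hε₀ : 0 < ε₀)
    (hH : ∀ ε ∈ Icc 0 ε₀, IsCaratheodory (H ε) g)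
    (hHc : ∀ᵐ s, ContinuousOn (fun p : ℝ × ℝ => H p.2 s p.1) (univ ×ˢ Icc 0 ε₀))
    {σ z : ℝ} (hz : 0 < σ * ∫ s in (0:ℝ)..T, H 0 s z) :
    ∀ᶠ ε in 𝓝[>] (0:ℝ), ∀ y : ℝ → ℝ, Continuous y → (∀ s, |y s - z| ≤ ε * ∫ s, g s) →
      0 < σ * ∫ s in (0:ℝ)..T, H ε s (y s) := by
  by_contra hcon
  have hfreq := (not_eventually.1 hcon).and_eventually (Ioc_mem_nhdsGT hε₀)
  obtain ⟨ε, hε, hbad⟩ := exists_seq_forall_of_frequently hfreq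
  have hmem : ∀ n, ε n ∈ Icc 0 ε₀ := fun n => Ioc_subset_Icc_self (hbad n).2
  have hbad' : ∀ n, ∃ y : ℝ → ℝ, Continuous y ∧ (∀ s, |y s - z| ≤ ε n * ∫ s, g s) ∧
      σ * ∫ s in (0:ℝ)..T, H (ε n) s (y s) ≤ 0 := by
    intro n
    have := (hbad n).1
    push Not at this
    exact this
  choose y hyc hyz hyI using hbad'
  have hε0 : Tendsto ε atTop (𝓝 0) := hε.mono_right nhdsWithin_le_nhds
  have hy : ∀ s, Tendsto (fun n => y n s) atTop (𝓝 z) := fun s =>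
    tendsto_iff_dist_tendsto_zero.2 (squeeze_zero (fun _ => dist_nonneg) (fun n => hyz n s)
      (by simpa using hε0.mul_const (∫ s, g s)))
  have hlim : Tendsto (fun n => ∫ s in (0:ℝ)..T, H (ε n) s (y n s)) atTop
      (𝓝 (∫ s in (0:ℝ)..T, H 0 s z)) := by
    refine intervalIntegral.tendsto_integral_filter_of_dominated_convergence g
      (Eventually.of_forall fun n =>
        ((hH _ (hmem n)).aestronglyMeasurable (hyc n).measurable).restrict)
      (Eventually.of_forall fun n => ?_)
      (hH 0 ⟨le_rfl, hε₀.le⟩).integrable_bound.intervalIntegrable ?_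
    · filter_upwards [(hH _ (hmem n)).bound] with s hs _ using hs _
    · filter_upwards [hHc] with s hs _
      have hs0 := hs (z, 0) ⟨mem_univ _, le_rfl, hε₀.le⟩
      exact Tendsto.comp hs0 (tendsto_nhdsWithin_iff.2
        ⟨(hy s).prodMk_nhds hε0, Eventually.of_forall fun n => ⟨mem_univ _, hmem n⟩⟩)
  exact hz.not_ge (le_of_tendsto (hlim.const_mul σ) (Eventually.of_forall hyI))

theorem eventually_exists_periodic (hε₀ : 0 < ε₀) (hT : 0 < T)
    (hH : ∀ ε ∈ Icc 0 ε₀, IsCaratheodory (H ε) g)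
    (hHc : ∀ᵐ s, ContinuousOn (fun p : ℝ × ℝ => H p.2 s p.1) (univ ×ˢ Icc 0 ε₀))
    {σ α β : ℝ} (hαβ : α ≤ β) (hα : 0 < σ * ∫ s in (0:ℝ)..T, H 0 s α)
    (hβ : σ * ∫ s in (0:ℝ)..T, H 0 s β < 0) :
    ∀ᶠ ε in 𝓝[>] (0:ℝ), ∃ x : ℝ → ℝ, Continuous x ∧ x 0 ∈ Icc α β ∧
      (∀ t, |x t - x 0| ≤ ε * ∫ s, g s) ∧ x T = x 0 ∧
      ∀ t ∈ Icc 0 T, x t = x 0 + ∫ s in (0:ℝ)..t, ε * H ε s (x s) := by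
  have hβ' : 0 < -σ * ∫ s in (0:ℝ)..T, H 0 s β := by linarith
  filter_upwards [eventually_mul_integral_pos hε₀ hH hHc hα,
    eventually_mul_integral_pos hε₀ hH hHc hβ', Ioc_mem_nhdsGT hε₀] with ε h1 h2 hε
  have := ((hH ε (Ioc_subset_Icc_self hε)).const_mul hε.1.le).exists_periodic (σ := σ) hT hαβ
  simp only [integral_const_mul, intervalIntegral.integral_const_mul] at this ⊢
  refine this (fun y hy hyz => ?_) (fun y hy hyz => ?_)
  · have := mul_pos hε.1 (h1 y hy hyz)
    linarith
  · have := mul_pos hε.1 (h2 y hy hyz)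
    linarith

end Family

theorem exists_periodic_extension {T : ℝ} (hT : 0 < T) {h : ℝ → ℝ → ℝ}
    (hper : ∀ t x, h (t + T) x = h t x) {x : ℝ → ℝ} (hxT : x T = x 0)
    (hint : IntervalIntegrable (fun s => h s (x s)) volume 0 T)
    (hx : ∀ t ∈ Icc 0 T, x t = x 0 + ∫ s in (0:ℝ)..t, h s (x s)) :
    ∃ φ : ℝ → ℝ, (∀ t, φ (t + T) = φ t) ∧
      (∀ u v : ℝ, IntervalIntegrable (fun s => h s (φ s)) volume u v) ∧
      (∀ u v : ℝ, φ v - φ u = ∫ s in u..v, h s (φ s)) ∧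
      ∀ t, ∃ s ∈ Icc 0 T, φ t = x s := by
  set φ : ℝ → ℝ := fun t => x (toIcoMod hT 0 t) with hφ
  have hφper : Function.Periodic φ T := fun t => by simp [hφ]
  have hφx : ∀ t ∈ Icc 0 T, φ t = x t := by
    intro t ht
    rcases ht.2.eq_or_lt with rfl | hlt
    · have h0 := hφper 0
      rw [zero_add] at h0
      rw [h0, hxT]
      simp [hφ]
    · simp only [hφ]
      rw [(toIcoMod_eq_self hT).2 ⟨ht.1, by simpa using hlt⟩]
  have hhper : Function.Periodic (fun s => h s (φ s)) T := fun s => by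
    simp only [hφper s, hper]
  have hi0 : IntervalIntegrable (fun s => h s (φ s)) volume 0 T := by
    refine hint.congr fun s hs => ?_
    rw [uIoc_of_le hT.le] at hs
    simp only [hφx s (Ioc_subset_Icc_self hs)]
  have hi := hhper.intervalIntegrable₀ hT.ne' hi0
  have hφsol : ∀ t ∈ Icc 0 T, φ t = x 0 + ∫ s in (0:ℝ)..t, h s (φ s) := by
    intro t ht
    rw [hφx t ht, hx t ht]
    congr 1
    refine intervalIntegral.integral_congr fun s hs => ?_
    rw [uIcc_of_le ht.1] at hs
    simp only [hφx s ⟨hs.1, hs.2.trans ht.2⟩]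
  have hmean : ∫ s in (0:ℝ)..T, h s (φ s) = 0 := by
    have := hφsol T ⟨hT.le, le_rfl⟩
    rw [hφx T ⟨hT.le, le_rfl⟩, hxT] at this
    linarith
  have hprim : Function.Periodic (fun t => x 0 + ∫ s in (0:ℝ)..t, h s (φ s)) T := by
    intro t
    simp only
    rw [← intervalIntegral.integral_add_adjacent_intervals (hi 0 t) (hi t (t + T)),
      hhper.intervalIntegral_add_eq t 0, zero_add, hmean, add_zero]
  have hφall : ∀ t, φ t = x 0 + ∫ s in (0:ℝ)..t, h s (φ s) := by
    intro t
    obtain ⟨s, hs, hst⟩ := (hφper.sub hprim).exists_mem_Ico₀ hT t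
    have := hφsol s (Ico_subset_Icc_self hs)
    simp only [Pi.sub_apply] at hst
    linarith
  refine ⟨φ, hφper, hi, fun u v => ?_, fun t =>
    ⟨_, Ico_subset_Icc_self (toIcoMod_mem_Ico' hT t), rfl⟩⟩
  rw [hφall u, hφall v, add_sub_add_left_eq_sub,
    intervalIntegral.integral_interval_sub_left (hi _ _) (hi _ _)]

/-- A diagonal choice: if for each `δ > 0` a property `P δ ε` is satisfiable for small `ε > 0`,
then one selection satisfies `P δ ε` for every `δ > 0` and all `ε > 0` small depending on `δ`. -/
theorem exists_eventually_forall_pos {X : Type*} [Nonempty X] {P : ℝ → ℝ → X → Prop}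
    (hmono : ∀ {δ δ' ε x}, δ ≤ δ' → P δ ε x → P δ' ε x)
    (h : ∀ δ > 0, ∀ᶠ ε in 𝓝[>] (0:ℝ), ∃ x, P δ ε x) :
    ∃ φ : ℝ → X, ∀ δ > 0, ∀ᶠ ε in 𝓝[>] (0:ℝ), P δ ε (φ ε) := by
  have hchoice : ∀ ε : ℝ, ∃ x : X, 0 < ε → ∀ δ > 0, (∃ x', P δ ε x') → P (δ + ε) ε x := by
    intro ε
    by_cases hε : 0 < ε ∧ {δ : ℝ | 0 < δ ∧ ∃ x', P δ ε x'}.Nonempty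
    · obtain ⟨δ₁, ⟨-, x, hx⟩, hlt⟩ := Real.lt_sInf_add_pos hε.2 hε.1
      refine ⟨x, fun _ δ hδ hP => hmono ?_ hx⟩
      have : sInf {δ : ℝ | 0 < δ ∧ ∃ x', P δ ε x'} ≤ δ :=
        csInf_le ⟨0, fun _ h => h.1.le⟩ ⟨hδ, hP⟩
      linarith
    · exact ⟨Classical.arbitrary X, fun h0 δ hδ hP => absurd ⟨h0, δ, hδ, hP⟩ hε⟩
  choose φ hφ using hchoice
  refine ⟨φ, fun δ hδ => ?_⟩
  filter_upwards [h (δ / 2) (half_pos hδ), Ioc_mem_nhdsGT (half_pos hδ)] with ε hP hε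
  exact hmono (by linarith [hε.2]) (hφ ε hε.1 (δ / 2) (half_pos hδ) hP)

/-- The field restricted to one period in time and clamped to `[a, b]` in space. -/
noncomputable def clampedField (f : ℝ → ℝ → ℝ → ℝ) (T : ℝ) {a b : ℝ} (hab : a ≤ b)
    (ε s x : ℝ) : ℝ :=
  (Ioc 0 T).indicator (fun s => f s (projIcc a b hab x) ε) s

section ClampedField

variable {f : ℝ → ℝ → ℝ → ℝ} {T a b : ℝ} {hab : a ≤ b}

theorem clampedField_eq {ε s x : ℝ} (hs : s ∈ Ioc 0 T) (hx : x ∈ Icc a b) :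
    clampedField f T hab ε s x = f s x ε := by
  rw [clampedField, indicator_of_mem hs, projIcc_of_mem hab hx]

theorem continuousOn_clampedField {D : Set ℝ} {ε₀ : ℝ} (habD : Icc a b ⊆ D)
    (hA1 : ∀ᵐ t ∂(volume.restrict (Icc (0:ℝ) T)),
      ContinuousOn (fun p : ℝ × ℝ => f t p.1 p.2) (D ×ˢ Icc (0:ℝ) ε₀)) :
    ∀ᵐ s, ContinuousOn (fun p : ℝ × ℝ => clampedField f T hab p.2 s p.1)
      (univ ×ˢ Icc 0 ε₀) := by
  filter_upwards [(ae_restrict_iff' measurableSet_Icc).1 hA1] with s hs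
  by_cases hsT : s ∈ Ioc 0 T
  · simp only [clampedField, indicator_of_mem hsT]
    have hproj : Continuous fun p : ℝ × ℝ => ((projIcc a b hab p.1 : ℝ), p.2) :=
      (continuous_subtype_val.comp (continuous_projIcc.comp continuous_fst)).prodMk
        continuous_snd
    exact (hs (Ioc_subset_Icc_self hsT)).comp hproj.continuousOn
      fun p hp => ⟨habD (projIcc a b hab p.1).2, hp.2⟩
  · simp only [clampedField, indicator_of_notMem hsT]
    exact continuousOn_const

theorem isCaratheodory_clampedField {D : Set ℝ} {ε₀ ε : ℝ} {g : ℝ → ℝ} (habD : Icc a b ⊆ D)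
    (hA1 : ∀ᵐ t ∂(volume.restrict (Icc (0:ℝ) T)),
      ContinuousOn (fun p : ℝ × ℝ => f t p.1 p.2) (D ×ˢ Icc (0:ℝ) ε₀))
    (hA2 : ∀ x ∈ D, ∀ ε ∈ Icc (0:ℝ) ε₀,
      AEStronglyMeasurable (fun t => f t x ε) (volume.restrict (Icc (0:ℝ) T)))
    (hg : IntegrableOn g (Icc 0 T))
    (hfg : ∀ᵐ t ∂(volume.restrict (Icc (0:ℝ) T)),
      ∀ x ∈ Icc a b, ∀ ε ∈ Icc (0:ℝ) ε₀, |f t x ε| ≤ g t)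
    (hε : ε ∈ Icc 0 ε₀) :
    IsCaratheodory (clampedField f T hab ε) ((Ioc 0 T).indicator g) where
  continuous := by
    filter_upwards [continuousOn_clampedField (hab := hab) habD hA1] with s hs
    exact hs.comp_continuous (continuous_id.prodMk continuous_const) fun x => ⟨mem_univ _, hε⟩
  measurable x := by
    refine (aestronglyMeasurable_indicator_iff measurableSet_Ioc).2 ?_
    exact (hA2 _ (habD (projIcc a b hab x).2) ε hε).mono_set Ioc_subset_Icc_self
  integrable_bound :=
    (integrable_indicator_iff measurableSet_Ioc).2 (hg.mono_set Ioc_subset_Icc_self)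
  bound := by
    filter_upwards [(ae_restrict_iff' measurableSet_Icc).1 hfg] with s hs x
    by_cases hsT : s ∈ Ioc 0 T
    · rw [clampedField, indicator_of_mem hsT, indicator_of_mem hsT]
      exact hs (Ioc_subset_Icc_self hsT) _ (projIcc a b hab x).2 ε hε
    · rw [clampedField, indicator_of_notMem hsT, indicator_of_notMem hsT, abs_zero]

end ClampedField

/-- A continuous function changing sign on `[a, b]` with a unique zero `c` has, up to the factor
`I a`, constant signs on both sides of `c`. -/
theorem sign_of_unique_zero {I : ℝ → ℝ} (hI : Continuous I) {a b c : ℝ}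
    (hsign : I a * I b < 0) (huniq : ∀ z ∈ Icc a b, z ≠ c → I z ≠ 0) {z : ℝ} (hz : z ∈ Icc a b) :
    (z < c → 0 < I a * I z) ∧ (c < z → I a * I z < 0) := by
  have ha : I a ≠ 0 := left_ne_zero_of_mul hsign.ne
  have hJ : Continuous fun z => I a * I z := continuous_const.mul hI
  constructor <;> intro hzc <;> by_contra! hcon
  · obtain ⟨w, hw, hw0⟩ := intermediate_value_Icc' hz.1 hJ.continuousOn
      ⟨hcon, mul_self_nonneg (I a)⟩
    exact huniq w ⟨hw.1, hw.2.trans hz.2⟩ (hw.2.trans_lt hzc).ne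
      ((mul_eq_zero.1 hw0).resolve_left ha)
  · obtain ⟨w, hw, hw0⟩ := intermediate_value_Icc' hz.2 hJ.continuousOn ⟨hsign.le, hcon⟩
    exact huniq w ⟨hz.1.trans hw.1, hw.2⟩ (hzc.trans_le hw.1).ne'
      ((mul_eq_zero.1 hw0).resolve_left ha)

/-- One-dimensional averaging theorem with convergence: under the hypotheses of the
one-dimensional averaging theorem, if moreover `z* ∈ (a,b)` is the unique zero of the
averaged function `f₁` in `[a,b]`, then the `T`-periodic solutions `φ(·,ε)` (with values
in `(a,b)`) can be chosen to converge uniformly to the constant `z*` as `ε → 0`. -/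
theorem averaging_one_dimensional_convergence
    (D : Set ℝ) (hD : IsOpen D)
    (T ε₀ : ℝ) (hT : 0 < T) (hε₀ : 0 < ε₀)
    (f : ℝ → ℝ → ℝ → ℝ)
    (hper : ∀ t x ε, f (t + T) x ε = f t x ε)
    (hA1 : ∀ᵐ t ∂(volume.restrict (Icc (0:ℝ) T)),
      ContinuousOn (fun p : ℝ × ℝ => f t p.1 p.2) (D ×ˢ Icc (0:ℝ) ε₀))
    (hA2 : ∀ x ∈ D, ∀ ε ∈ Icc (0:ℝ) ε₀,
      AEStronglyMeasurable (fun t => f t x ε) (volume.restrict (Icc (0:ℝ) T)))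
    (hA3 : ∀ r > (0:ℝ), ∃ g : ℝ → ℝ, IntegrableOn g (Icc (0:ℝ) T) ∧
      ∀ᵐ t ∂(volume.restrict (Icc (0:ℝ) T)),
        ∀ x ∈ D, ∀ ε ∈ Icc (0:ℝ) ε₀, ‖(x, ε)‖ ≤ r → |f t x ε| ≤ g t)
    (a b : ℝ) (hab : a < b) (habD : Icc a b ⊆ D)
    (f₁ : ℝ → ℝ) (hf₁ : ∀ z, f₁ z = (1 / T) * ∫ t in (0:ℝ)..T, f t z 0)
    (hsign : f₁ a * f₁ b < 0)
    (zstar : ℝ) (hzstar_mem : zstar ∈ Ioo a b)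
    (hzstar_zero : f₁ zstar = 0)
    (hzstar_unique : ∀ z ∈ Icc a b, z ≠ zstar → f₁ z ≠ 0) :
    ∃ εV : ℝ, 0 < εV ∧ εV ≤ ε₀ ∧ ∃ φ : ℝ → ℝ → ℝ,
      (∀ ε ∈ Icc (0:ℝ) εV,
        (∀ t, φ ε (t + T) = φ ε t) ∧
        (∀ t, φ ε t ∈ D) ∧
        (∀ u v : ℝ, IntervalIntegrable (fun s => ε * f s (φ ε s) ε) volume u v) ∧
        (∀ u v : ℝ, φ ε v - φ ε u = ∫ s in u..v, ε * f s (φ ε s) ε) ∧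
        (∀ t ∈ Icc (0:ℝ) T, φ ε t ∈ Ioo a b)) ∧
      TendstoUniformlyOn (fun ε t => φ ε t) (fun _ => zstar)
        (nhdsWithin 0 (Icc (0:ℝ) εV)) (Icc (0:ℝ) T) := by
  obtain ⟨g, hg, hfg⟩ := hA3 (max |a| |b| + ε₀) (by positivity)
  have hfg' : ∀ᵐ t ∂(volume.restrict (Icc (0:ℝ) T)),
      ∀ x ∈ Icc a b, ∀ ε ∈ Icc (0:ℝ) ε₀, |f t x ε| ≤ g t := by
    filter_upwards [hfg] with t ht x hx ε hε
    refine ht x (habD hx) ε hε ?_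
    have hx' : |x| ≤ max |a| |b| := abs_le_max_abs_abs hx.1 hx.2
    have hε' : |ε| ≤ ε₀ := by rw [abs_of_nonneg hε.1]; exact hε.2
    rw [Prod.norm_def, Real.norm_eq_abs, Real.norm_eq_abs]
    exact max_le (by linarith) (by linarith [abs_nonneg x])
  set H := clampedField f T hab.le with hHdef
  set g' := (Ioc 0 T).indicator g
  have hH : ∀ ε ∈ Icc 0 ε₀, IsCaratheodory (H ε) g' := fun ε hε =>
    isCaratheodory_clampedField habD hA1 hA2 hg hfg' hε
  have hHc := continuousOn_clampedField (hab := hab.le) habD hA1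
  set I : ℝ → ℝ := fun z => ∫ s in (0:ℝ)..T, H 0 s z
  have hIcont : Continuous I := continuous_iff_continuousAt.2 fun z =>
    (hH 0 ⟨le_rfl, hε₀.le⟩).tendsto_integral (y := fun w _ => w) (y₀ := fun _ => z)
      (fun _ => measurable_const) (fun _ => tendsto_id) 0 T
  have hIf : ∀ z ∈ Icc a b, I z = T * f₁ z := by
    intro z hz
    rw [hf₁, ← mul_assoc, mul_one_div_cancel hT.ne', one_mul]
    refine intervalIntegral.integral_congr_ae (Eventually.of_forall fun s hs => ?_)
    rw [uIoc_of_le hT.le] at hs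
    exact clampedField_eq hs hz
  have hIsign : I a * I b < 0 := by
    rw [hIf a (left_mem_Icc.2 hab.le), hIf b (right_mem_Icc.2 hab.le)]
    nlinarith [mul_pos hT hT]
  have hIuniq : ∀ z ∈ Icc a b, z ≠ zstar → I z ≠ 0 := fun z hz hne => by
    rw [hIf z hz]
    exact mul_ne_zero hT.ne' (hzstar_unique z hz hne)
  have hnear : ∀ δ > 0, ∀ᶠ ε in 𝓝[>] (0:ℝ), ∃ φ : ℝ → ℝ,
      ((∀ t, φ (t + T) = φ t) ∧
        (∀ u v : ℝ, IntervalIntegrable (fun s => ε * f s (φ s) ε) volume u v) ∧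
        (∀ u v : ℝ, φ v - φ u = ∫ s in u..v, ε * f s (φ s) ε) ∧
        ∀ t, φ t ∈ Ioo a b) ∧ ∀ t, |φ t - zstar| < δ := by
    intro δ hδ
    obtain ⟨η, hη, hηδ, hηa, hηb⟩ : ∃ η > 0, 2 * η ≤ δ ∧ 2 * η ≤ zstar - a ∧
        2 * η ≤ b - zstar := by
      have h1 := sub_pos.2 hzstar_mem.1
      have h2 := sub_pos.2 hzstar_mem.2
      refine ⟨min δ (min (zstar - a) (b - zstar)) / 2, by positivity, ?_, ?_, ?_⟩ <;>
        rw [mul_div_cancel₀ _ two_ne_zero]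
      · exact min_le_left _ _
      · exact (min_le_right _ _).trans (min_le_left _ _)
      · exact (min_le_right _ _).trans (min_le_right _ _)
    have hα := (sign_of_unique_zero hIcont hIsign hIuniq (z := zstar - η)
      ⟨by linarith, by linarith⟩).1 (by linarith)
    have hβ := (sign_of_unique_zero hIcont hIsign hIuniq (z := zstar + η)
      ⟨by linarith, by linarith⟩).2 (by linarith)
    have hsmall : ∀ᶠ ε in 𝓝[>] (0:ℝ), ε * ∫ s, g' s < η := by
      have h0 : Tendsto (fun ε : ℝ => ε * ∫ s, g' s) (𝓝[>] 0) (𝓝 0) := by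
        simpa using ((tendsto_id (x := 𝓝 (0:ℝ))).mono_left
          nhdsWithin_le_nhds).mul_const (∫ s, g' s)
      exact h0.eventually_lt_const hη
    filter_upwards [eventually_exists_periodic hε₀ hT hH hHc (by linarith) hα hβ, hsmall,
      Ioc_mem_nhdsGT hε₀] with ε ⟨x, hxc, hx0, hxdev, hxT, hx⟩ hεη hε
    have hxnear : ∀ t, |x t - zstar| < 2 * η := by
      intro t
      have h1 := abs_le.1 (hxdev t)
      exact abs_lt.2 ⟨by linarith [hx0.1], by linarith [hx0.2]⟩
    have hxab : ∀ t, x t ∈ Ioo a b := fun t => by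
      have h1 := abs_lt.1 (hxnear t)
      exact ⟨by linarith, by linarith⟩
    have hHf : ∀ s ∈ Ioc 0 T, ε * H ε s (x s) = ε * f s (x s) ε := fun s hs => by
      rw [hHdef, clampedField_eq hs (Ioo_subset_Icc_self (hxab s))]
    have hint : IntervalIntegrable (fun s => ε * H ε s (x s)) volume 0 T :=
      (((hH ε (Ioc_subset_Icc_self hε)).integrable hxc.measurable).const_mul
        ε).intervalIntegrable
    obtain ⟨φ, hφper, hφint, hφeq, hφx⟩ :=
      exists_periodic_extension hT (h := fun s x => ε * f s x ε)
        (fun t x => by simp only [hper]) hxT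
        (hint.congr fun s hs => hHf s (by rwa [uIoc_of_le hT.le] at hs)) (fun t ht => by
          rw [hx t ht]
          congr 1
          refine intervalIntegral.integral_congr_ae (Eventually.of_forall fun s hs => ?_)
          rw [uIoc_of_le ht.1] at hs
          exact hHf s ⟨hs.1, hs.2.trans ht.2⟩)
    refine ⟨φ, ⟨hφper, hφint, hφeq, fun t => ?_⟩, fun t => ?_⟩ <;>
      obtain ⟨s, -, hs⟩ := hφx t <;> rw [hs]
    · exact hxab s
    · exact (hxnear s).trans_le hηδ
  obtain ⟨φ, hφ⟩ := exists_eventually_forall_pos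
    (fun hδ h => ⟨h.1, fun t => (h.2 t).trans_le hδ⟩) hnear
  obtain ⟨ε₁, hε₁, hφ₁⟩ := mem_nhdsGT_iff_exists_Ioc_subset.1 (hφ 1 one_pos)
  have hε₁' : 0 < ε₁ := hε₁
  set ψ : ℝ → ℝ → ℝ := fun ε => if ε = 0 then fun _ => zstar else φ ε
  have hψ0 : ψ 0 = fun _ => zstar := if_pos rfl
  have hψpos : ∀ {ε : ℝ}, 0 < ε → ψ ε = φ ε := fun hε => if_neg hε.ne'
  refine ⟨min ε₁ ε₀, lt_min hε₁' hε₀, min_le_right _ _, ψ, fun ε hε => ?_, ?_⟩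
  · rcases hε.1.eq_or_lt with rfl | hpos
    · simp only [hψ0, zero_mul, sub_self, intervalIntegral.integral_zero, implies_true, true_and]
      exact ⟨fun _ => habD (Ioo_subset_Icc_self hzstar_mem),
        fun _ _ => intervalIntegrable_const, fun _ _ => hzstar_mem⟩
    · rw [hψpos hpos]
      obtain ⟨⟨h1, h2, h3, h4⟩, -⟩ := hφ₁ ⟨hpos, hε.2.trans (min_le_left _ _)⟩
      exact ⟨h1, fun t => habD (Ioo_subset_Icc_self (h4 t)), h2, h3, fun t _ => h4 t⟩
  · refine Metric.tendstoUniformlyOn_iff.2 fun δ hδ => ?_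
    filter_upwards [nhdsWithin_le_nhds (eventually_nhdsWithin_iff.1 (hφ δ hδ)),
      self_mem_nhdsWithin] with ε hεφ hε t _
    rw [dist_comm, Real.dist_eq]
    rcases hε.1.eq_or_lt with rfl | hpos
    · simpa [hψ0] using hδ
    · rw [hψpos hpos]
      exact (hεφ hpos).2 t
end

section
/- Assume f : ℝ × D × [0,ε₀] → ℝⁿ satisfies conditions A.1–A.3 and is T-periodic in t. Let V ⊂ ℝⁿ be open and bounded with closure(V) ⊆ D, and suppose there exists z* ∈ V such that: f₁(z*) = 0; f₁(z) ≠ 0 for every z ∈ closure(V) \ {z*}; f₁ is differentiable in a neighbourhood of z*; and det(Df₁(z*)) ≠ 0. Then there exists ε_V ∈ (0,ε₀] such that for every ε ∈ [0,ε_V] the differential equation x′ = ε f(t,x,ε) admits a T-periodic solution φ(·,ε) with φ(t,ε) ∈ V for all t ∈ [0,T], and these solutions can be chosen so that φ(·,ε) converges uniformly to the constant z* as ε → 0. -/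
open MeasureTheory Set

open Metric Filter Topology Module

theorem ContinuousLinearMap.det_one_add_pos {E : Type*} [NormedAddCommGroup E] [NormedSpace ℝ E]
    [FiniteDimensional ℝ E] {A : E →L[ℝ] E} (hA : ‖A‖ < 1) : 0 < (1 + A).det := by
  have : CompleteSpace E := FiniteDimensional.complete ℝ E
  have hne : ∀ s ∈ Icc (0 : ℝ) 1, (1 + s • A).det ≠ 0 := by
    intro s hs
    have hlt : ‖-(s • A)‖ < 1 := by
      rw [norm_neg, norm_smul, Real.norm_of_nonneg hs.1]
      nlinarith [hs.2, norm_nonneg A]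
    have hu : IsUnit (1 + s • A) := by
      have := isUnit_one_sub_of_norm_lt_one hlt
      rwa [sub_neg_eq_add] at this
    have h2 : IsUnit ((1 + s • A : E →L[ℝ] E) : E →ₗ[ℝ] E) :=
      hu.map (ContinuousLinearMap.toLinearMapRingHom : (E →L[ℝ] E) →+* (E →ₗ[ℝ] E))
    exact ((LinearMap.isUnit_iff_isUnit_det _).1 h2).ne_zero
  have hc : ContinuousOn (fun s : ℝ => (1 + s • A).det) (Icc 0 1) :=
    (ContinuousLinearMap.continuous_det.comp (by fun_prop)).continuousOn
  by_contra hneg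
  have hmem : (0 : ℝ) ∈ Icc ((1 + (1 : ℝ) • A).det) ((1 + (0 : ℝ) • A).det) := by
    rw [one_smul, zero_smul, add_zero]
    exact ⟨not_lt.1 hneg, by rw [ContinuousLinearMap.det]; simp⟩
  obtain ⟨s, hs, h0⟩ := intermediate_value_Icc' zero_le_one hc hmem
  exact hne s hs h0

/-- `det (1 + t • M)` is a polynomial in `t` of degree at most `finrank ℝ E`, hence is determined
by Lagrange interpolation at `finrank ℝ E + 1` nodes. -/
theorem ContinuousLinearMap.det_one_add_eq_sum_lagrange {E : Type*} [NormedAddCommGroup E]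
    [NormedSpace ℝ E] [FiniteDimensional ℝ E] (s : Finset ℝ) (hs : finrank ℝ E < s.card)
    (M : E →L[ℝ] E) :
    (1 + M).det = ∑ t ∈ s, (Lagrange.basis s id t).eval 1 * (1 + t • M).det := by
  classical
  let b := finBasis ℝ E
  let A := LinearMap.toMatrix b b (M : E →ₗ[ℝ] E)
  let p : Polynomial ℝ := Matrix.det
    ((Polynomial.X : Polynomial ℝ) • A.map Polynomial.C + (1 : Matrix _ _ ℝ).map Polynomial.C)
  have hp : ∀ t : ℝ, p.eval t = (1 + t • M).det := by
    intro t
    rw [ContinuousLinearMap.det, ← LinearMap.det_toMatrix b]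
    have : LinearMap.toMatrix b b ((1 + t • M : E →L[ℝ] E) : E →ₗ[ℝ] E) = t • A + 1 := by
      rw [ContinuousLinearMap.toLinearMap_add, ContinuousLinearMap.toLinearMap_smul,
        map_add, map_smul, add_comm]
      congr 1
      exact LinearMap.toMatrix_one b
    rw [this, ← Polynomial.coe_evalRingHom, RingHom.map_det]
    congr 1
    clear_value A
    ext i j
    simp only [RingHom.mapMatrix_apply, Matrix.map_apply, Matrix.add_apply, Matrix.smul_apply,
      smul_eq_mul, Polynomial.coe_evalRingHom, Polynomial.eval_add, Polynomial.eval_mul,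
      Polynomial.eval_X, Polynomial.eval_C]
  have hdeg : p.degree < s.card := by
    refine lt_of_le_of_lt Polynomial.degree_le_natDegree ?_
    have := Polynomial.natDegree_det_X_add_C_le A 1
    rw [Fintype.card_fin] at this
    exact_mod_cast this.trans_lt hs
  have h := Lagrange.eq_interpolate_of_eval_eq (s := s) (v := id) (f := p)
    (fun t => (1 + t • M).det) (injOn_id _) hdeg (fun t _ => hp t)
  have h1 : p.eval 1 = (1 + M).det := by rw [hp, one_smul]
  rw [← h1, h, Lagrange.interpolate_apply, Polynomial.eval_finsetSum]
  refine Finset.sum_congr rfl fun t _ => ?_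
  simp [mul_comm]

theorem Lagrange.sum_eval_basis {s : Finset ℝ} (hs : s.Nonempty) (x : ℝ) :
    ∑ t ∈ s, (Lagrange.basis s id t).eval x = 1 := by
  rw [← Polynomial.eval_finsetSum, Lagrange.sum_basis (injOn_id _) hs, Polynomial.eval_one]

section Brouwer

variable {E : Type*} [NormedAddCommGroup E] [InnerProductSpace ℝ E] [FiniteDimensional ℝ E]

theorem image_ball_eq_ball_of_hasStrictFDerivAt {F : E → E} {F' : E → E →L[ℝ] E}
    (hc : ContinuousOn F (closedBall 0 1))
    (hF' : ∀ x ∈ ball (0 : E) 1, HasStrictFDerivAt F (F' x) x)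
    (hdet : ∀ x ∈ ball (0 : E) 1, (F' x).det ≠ 0)
    (hmaps : MapsTo F (ball 0 1) (ball 0 1)) (hsphere : ∀ x ∈ sphere (0 : E) 1, F x = x) :
    F '' ball 0 1 = ball 0 1 := by
  have : CompleteSpace E := FiniteDimensional.complete ℝ E
  have hopen : IsOpen (F '' ball 0 1) := by
    rw [isOpen_iff_mem_nhds]
    rintro _ ⟨x, hx, rfl⟩
    have hsurj : (F' x).range = ⊤ := by
      have h := (LinearMap.isUnit_iff_isUnit_det (F' x : E →ₗ[ℝ] E)).2 (hdet x hx).isUnit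
      exact (LinearMap.isUnit_iff_range_eq_top _).1 h
    rw [← (hF' x hx).map_nhds_eq_of_surj hsurj]
    exact image_mem_map (isOpen_ball.mem_nhds hx)
  refine Subset.antisymm hmaps.image_subset ?_
  refine (convex_ball (0 : E) 1).isPreconnected.subset_of_closure_inter_subset hopen ?_ ?_
  · have h0 : (0 : E) ∈ ball (0 : E) 1 := mem_ball_self one_pos
    exact ⟨F 0, hmaps h0, mem_image_of_mem F h0⟩
  · rintro y ⟨hy, hy1⟩
    have hK : IsClosed (F '' closedBall 0 1) :=
      ((isCompact_closedBall (0 : E) 1).image_of_continuousOn hc).isClosed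
    obtain ⟨x, hx, rfl⟩ := closure_minimal (image_mono ball_subset_closedBall) hK hy
    rcases (mem_closedBall.1 hx).lt_or_eq with h | h
    · exact mem_image_of_mem F h
    · rw [hsphere x h] at hy1
      exact absurd hy1 (by simpa using (mem_sphere.1 h).ge)

theorem not_exists_contDiffAt_retraction_sphere {r : E → E}
    (hr : ∀ x ∈ closedBall (0 : E) 1, ContDiffAt ℝ 1 r x)
    (hmaps : ∀ x ∈ closedBall (0 : E) 1, ‖r x‖ = 1) (hid : ∀ x ∈ sphere (0 : E) 1, r x = x) :
    False := by
  have : CompleteSpace E := FiniteDimensional.complete ℝ E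
  borelize E
  let g : E → E := fun x => r x - x
  have hg : ∀ x ∈ closedBall (0 : E) 1, ContDiffAt ℝ 1 g x := fun x hx =>
    (hr x hx).sub contDiffAt_id
  have hg' : ContinuousOn (fderiv ℝ g) (closedBall 0 1) := fun x hx =>
    ((hg x hx).fderiv_right (m := 0) (by norm_num)).continuousAt.continuousWithinAt
  obtain ⟨C, hC⟩ := (isCompact_closedBall (0 : E) 1).exists_bound_of_continuousOn hg'
  have hC0 : 0 ≤ C := (norm_nonneg _).trans (hC 0 (by simp))
  have hlip : ∀ x ∈ closedBall (0 : E) 1, ∀ y ∈ closedBall (0 : E) 1,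
      ‖g y - g x‖ ≤ C * ‖y - x‖ := fun x hx y hy =>
    (convex_closedBall (0 : E) 1).norm_image_sub_le_of_norm_fderiv_le
      (fun z hz => (hg z hz).differentiableAt one_ne_zero) hC hx hy
  have hdetc : ∀ t : ℝ, ContinuousOn (fun x => (1 + t • fderiv ℝ g x).det) (closedBall 0 1) :=
    fun t => ContinuousLinearMap.continuous_det.comp_continuousOn
      (continuousOn_const.add (hg'.const_smul t))
  have hintegr : ∀ t : ℝ, IntegrableOn (fun x => (1 + t • fderiv ℝ g x).det) (ball 0 1) volume :=
    fun t => ((hdetc t).integrableOn_compact (isCompact_closedBall _ _)).mono_set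
      ball_subset_closedBall
  have hvol : ∀ t : ℝ, 0 ≤ t → t < 1 → t * C < 1 →
      ∫ x in ball (0 : E) 1, (1 + t • fderiv ℝ g x).det = volume.real (ball (0 : E) 1) := by
    intro t ht0 ht1 htC
    let F : E → E := fun x => x + t • g x
    have hF : ∀ x ∈ closedBall (0 : E) 1, HasStrictFDerivAt F (1 + t • fderiv ℝ g x) x :=
      fun x hx => (hasStrictFDerivAt_id x).add
        (((hg x hx).hasStrictFDerivAt one_ne_zero).const_smul t)
    have hpos : ∀ x ∈ closedBall (0 : E) 1, 0 < (1 + t • fderiv ℝ g x).det := fun x hx => by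
      refine ContinuousLinearMap.det_one_add_pos ?_
      rw [norm_smul, Real.norm_of_nonneg ht0]
      exact (mul_le_mul_of_nonneg_left (hC x hx) ht0).trans_lt htC
    have hinj : InjOn F (ball 0 1) := by
      intro x hx y hy hxy
      by_contra hne
      have h1 : y - x = -(t • (g y - g x)) := by
        have : x + t • g x = y + t • g y := hxy
        rw [smul_sub, neg_sub, sub_eq_sub_iff_add_eq_add, ← this, add_comm]
      have h2 := hlip x (ball_subset_closedBall hx) y (ball_subset_closedBall hy)
      have h3 : ‖y - x‖ = t * ‖g y - g x‖ := by
        conv_lhs => rw [h1]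
        rw [norm_neg, norm_smul, Real.norm_of_nonneg ht0]
      have h4 : 0 < ‖y - x‖ := norm_pos_iff.2 (sub_ne_zero.2 (Ne.symm hne))
      nlinarith [mul_le_mul_of_nonneg_left h2 ht0]
    have himg : F '' ball 0 1 = ball 0 1 := by
      refine image_ball_eq_ball_of_hasStrictFDerivAt
        (fun x hx => (hF x hx).continuousAt.continuousWithinAt)
        (fun x hx => hF x (ball_subset_closedBall hx))
        (fun x hx => (hpos x (ball_subset_closedBall hx)).ne') ?_ ?_
      · intro x hx
        have hFx : F x = (1 - t) • x + t • r x := by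
          simp only [F, g]; module
        rw [mem_ball_zero_iff] at hx ⊢
        rw [hFx]
        refine (norm_add_le _ _).trans_lt ?_
        rw [norm_smul, norm_smul, Real.norm_of_nonneg ht0, Real.norm_of_nonneg (by linarith),
          hmaps x (mem_closedBall_zero_iff.2 hx.le)]
        nlinarith
      · intro x hx
        simp [F, g, hid x hx]
    have hcov := integral_image_eq_integral_abs_det_fderiv_smul volume measurableSet_ball
      (fun x hx => (hF x (ball_subset_closedBall hx)).hasFDerivAt.hasFDerivWithinAt) hinj
      (fun _ => (1 : ℝ))
    rw [himg] at hcov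
    simp only [integral_const, smul_eq_mul, mul_one, measureReal_restrict_apply_univ] at hcov
    rw [hcov]
    exact setIntegral_congr_fun measurableSet_ball fun x hx =>
      (abs_of_pos (hpos x (ball_subset_closedBall hx))).symm
  obtain ⟨s, hs, hcard⟩ :=
    (Ioo_infinite (show (0 : ℝ) < 1 / (C + 1) by positivity)).exists_subset_card_eq
      (finrank ℝ E + 1)
  have hsum : ∫ x in ball (0 : E) 1, (1 + fderiv ℝ g x).det = volume.real (ball (0 : E) 1) := by
    have hlt : finrank ℝ E < s.card := by omega
    rw [integral_congr_ae (Eventually.of_forall fun x =>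
      ContinuousLinearMap.det_one_add_eq_sum_lagrange s hlt (fderiv ℝ g x)),
      integral_finsetSum _ fun t _ => (hintegr t).const_mul _]
    have hs' : ∀ t ∈ s, ∫ x in ball (0 : E) 1,
        (Lagrange.basis s id t).eval 1 * (1 + t • fderiv ℝ g x).det =
        (Lagrange.basis s id t).eval 1 * volume.real (ball (0 : E) 1) := by
      intro t ht
      obtain ⟨h0, h1⟩ := hs ht
      rw [lt_div_iff₀ (by positivity)] at h1
      rw [integral_const_mul, hvol t h0.le (by nlinarith) (by nlinarith)]
    rw [Finset.sum_congr rfl hs', ← Finset.sum_mul,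
      Lagrange.sum_eval_basis (Finset.card_pos.1 (by omega)), one_mul]
  have hzero : ∀ x ∈ ball (0 : E) 1, (1 + fderiv ℝ g x).det = 0 := by
    intro x hx
    have hx' := ball_subset_closedBall hx
    have hrd : HasFDerivAt r (1 + fderiv ℝ g x) x := by
      have h := (hasFDerivAt_id (𝕜 := ℝ) x).add
        ((hg x hx').differentiableAt one_ne_zero).hasFDerivAt
      refine h.congr_of_eventuallyEq (Eventually.of_forall fun y => ?_)
      simp [g]
    have hconst : (fun y => ‖r y‖ ^ 2) =ᶠ[𝓝 x] fun _ => (1 : ℝ) := by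
      filter_upwards [isOpen_ball.mem_nhds hx] with y hy
      rw [hmaps y (ball_subset_closedBall hy), one_pow]
    have horth : ∀ v, inner ℝ (r x) ((1 + fderiv ℝ g x) v) = 0 := by
      intro v
      have h1 := hrd.norm_sq
      have h2 := h1.unique ((hasFDerivAt_const (1 : ℝ) x).congr_of_eventuallyEq hconst)
      have h3 := congrArg (fun L : E →L[ℝ] ℝ => L v) h2
      rw [two_nsmul] at h3
      exact (by simpa [← two_mul, inner_add_right, ← mul_add] using h3)
    by_contra hne
    have hu := (LinearMap.isUnit_iff_isUnit_det
      ((1 + fderiv ℝ g x : E →L[ℝ] E) : E →ₗ[ℝ] E)).2 (Ne.isUnit hne)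
    obtain ⟨v, hv⟩ := LinearMap.range_eq_top.1 ((LinearMap.isUnit_iff_range_eq_top _).1 hu) (r x)
    have h4 := horth v
    have h5 : (1 + fderiv ℝ g x) v = r x := hv
    rw [h5, real_inner_self_eq_norm_sq, hmaps x hx'] at h4
    norm_num at h4
  rw [setIntegral_congr_fun measurableSet_ball hzero, integral_zero] at hsum
  have hposvol : 0 < volume.real (ball (0 : E) 1) :=
    ENNReal.toReal_pos (measure_ball_pos volume 0 one_pos).ne' measure_ball_lt_top.ne
  exact hposvol.ne hsum

theorem exists_fixedPoint_of_contDiff {g : E → E} (hg : ContDiff ℝ 1 g)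
    (hmaps : MapsTo g (closedBall 0 1) (closedBall 0 1)) :
    ∃ x ∈ closedBall (0 : E) 1, g x = x := by
  by_contra! hfix
  let u : E → E := fun x => x - g x
  let b : E → ℝ := fun x => inner ℝ x (u x)
  let d : E → ℝ := fun x => b x ^ 2 + ‖u x‖ ^ 2 * (1 - ‖x‖ ^ 2)
  have hu : ∀ x ∈ closedBall (0 : E) 1, 0 < ‖u x‖ := fun x hx =>
    norm_pos_iff.2 (sub_ne_zero.2 (hfix x hx).symm)
  have hb : ∀ x ∈ closedBall (0 : E) 1, ‖x‖ = 1 → 0 < b x := by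
    intro x hx h1
    have h2 : ‖g x‖ ≤ 1 := mem_closedBall_zero_iff.1 (hmaps hx)
    have h3 : ‖g x‖ ^ 2 = ‖x‖ ^ 2 - 2 * inner ℝ x (u x) + ‖u x‖ ^ 2 := by
      rw [← norm_sub_sq_real]; simp [u]
    have h4 := hu x hx
    have h5 : ‖g x‖ ^ 2 ≤ 1 := pow_le_one₀ (norm_nonneg _) h2
    simp only [b]
    rw [h1] at h3
    nlinarith
  have hd : ∀ x ∈ closedBall (0 : E) 1, 0 < d x := by
    intro x hx
    have h4 := hu x hx
    rcases (mem_closedBall_zero_iff.1 hx).lt_or_eq with h | h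
    · have h5 : ‖x‖ ^ 2 < 1 := pow_lt_one₀ (norm_nonneg _) h two_ne_zero
      exact add_pos_of_nonneg_of_pos (sq_nonneg _) (mul_pos (pow_pos h4 2) (sub_pos.2 h5))
    · exact add_pos_of_pos_of_nonneg (pow_pos (hb x hx h) 2) (by rw [h]; norm_num)
  let c : E → ℝ := fun x => (-b x + √(d x)) / ‖u x‖ ^ 2
  have hu1 : ContDiff ℝ 1 u := contDiff_id.sub hg
  have hb1 : ContDiff ℝ 1 b := contDiff_id.inner ℝ hu1
  have hd1 : ContDiff ℝ 1 d :=
    (hb1.pow 2).add ((hu1.norm_sq ℝ).mul (contDiff_const.sub (contDiff_id.norm_sq ℝ)))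
  refine not_exists_contDiffAt_retraction_sphere (r := fun x => x + c x • u x) ?_ ?_ ?_
  · intro x hx
    have hc1 : ContDiffAt ℝ 1 c x :=
      (hb1.contDiffAt.neg.add (hd1.contDiffAt.sqrt (hd x hx).ne')).div
        (hu1.norm_sq ℝ).contDiffAt (pow_pos (hu x hx) 2).ne'
    exact contDiffAt_id.add (hc1.smul hu1.contDiffAt)
  · intro x hx
    have h4 := (pow_pos (hu x hx) 2).ne'
    have hsq := Real.sq_sqrt (hd x hx).le
    have hcu : c x * ‖u x‖ ^ 2 = -b x + √(d x) := div_mul_cancel₀ _ h4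
    have h1 : ‖x + c x • u x‖ ^ 2 = 1 := by
      rw [norm_add_sq_real, inner_smul_right, norm_smul, mul_pow, Real.norm_eq_abs, sq_abs]
      refine mul_left_cancel₀ h4 ?_
      have : ‖u x‖ ^ 2 * (‖x‖ ^ 2 + 2 * (c x * b x) + c x ^ 2 * ‖u x‖ ^ 2)
          = ‖u x‖ ^ 2 * ‖x‖ ^ 2 + 2 * (c x * ‖u x‖ ^ 2) * b x + (c x * ‖u x‖ ^ 2) ^ 2 := by ring
      refine this.trans ?_
      rw [hcu]
      simp only [d] at hsq ⊢
      linear_combination hsq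
    exact (pow_eq_one_iff_of_nonneg (norm_nonneg _) two_ne_zero).1 h1
  · intro x hx
    have h1 : ‖x‖ = 1 := mem_sphere_zero_iff_norm.1 hx
    have h2 : d x = b x ^ 2 := by simp [d, h1]
    have h3 : c x = 0 := by
      simp only [c]
      rw [h2, Real.sqrt_sq (hb x (sphere_subset_closedBall hx) h1).le]
      simp
    simp [h3]

theorem exists_fixedPoint_of_continuous {g : E → E} (hg : Continuous g)
    (hmaps : MapsTo g (closedBall 0 1) (closedBall 0 1)) :
    ∃ x ∈ closedBall (0 : E) 1, g x = x := by
  by_contra! hfix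
  obtain ⟨x₀, hx₀, hmin⟩ := (isCompact_closedBall (0 : E) 1).exists_isMinOn
    ⟨0, mem_closedBall_self zero_le_one⟩ ((hg.sub continuous_id).norm.continuousOn)
  set μ : ℝ := ‖g x₀ - x₀‖ with hμ
  have hμ0 : 0 < μ := norm_pos_iff.2 (sub_ne_zero.2 (hfix x₀ hx₀))
  obtain ⟨p, hp, hpg, -⟩ := hg.exists_contDiff_approx 1 (ε := fun _ => μ / 3) continuous_const
    (fun _ => by positivity)
  have hk : 0 < 1 + μ / 3 := by positivity
  have hpn : ∀ x ∈ closedBall (0 : E) 1, ‖p x‖ ≤ 1 + μ / 3 := by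
    intro x hx
    have h1 := mem_closedBall_zero_iff.1 (hmaps hx)
    have h2 := hpg x
    rw [dist_eq_norm] at h2
    have h3 := norm_add_le (p x - g x) (g x)
    rw [sub_add_cancel] at h3
    linarith
  obtain ⟨x, hx, hfx⟩ := exists_fixedPoint_of_contDiff (g := fun x => (1 + μ / 3)⁻¹ • p x)
    (contDiff_const.smul hp) (fun x hx => by
      rw [mem_closedBall_zero_iff, norm_smul, norm_inv, Real.norm_of_nonneg hk.le,
        inv_mul_le_one₀ hk]
      exact hpn x hx)
  have h1 : p x = (1 + μ / 3) • x := (inv_smul_eq_iff₀ hk.ne').1 hfx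
  have h2 : μ ≤ ‖g x - x‖ := hmin hx
  have h3 : g x - x = -(p x - g x) + (μ / 3) • x := by rw [h1]; module
  have h4 := norm_add_le (-(p x - g x)) ((μ / 3) • x)
  rw [← h3, norm_neg, norm_smul, Real.norm_of_nonneg (by positivity)] at h4
  have h5 := hpg x
  rw [dist_eq_norm] at h5
  have h6 := mem_closedBall_zero_iff.1 hx
  nlinarith

/-- **Brouwer's fixed point theorem** for closed balls of a finite-dimensional inner product
space. -/
theorem exists_fixedPoint_of_mapsTo_closedBall {g : E → E} {c : E} {R : ℝ} (hR : 0 < R)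
    (hg : ContinuousOn g (closedBall c R)) (hmaps : MapsTo g (closedBall c R) (closedBall c R)) :
    ∃ x ∈ closedBall c R, g x = x := by
  obtain ⟨G, hG⟩ := ContinuousMap.exists_restrict_eq (isClosed_closedBall (x := c) (ε := R))
    ⟨_, hg.domRestrict⟩
  have hGg : ∀ x ∈ closedBall c R, G x = g x := fun x hx => DFunLike.congr_fun hG ⟨x, hx⟩
  have hmem : ∀ x ∈ closedBall (0 : E) 1, c + R • x ∈ closedBall c R := by
    intro x hx
    rw [mem_closedBall_iff_norm, add_sub_cancel_left, norm_smul, Real.norm_of_nonneg hR.le]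
    exact mul_le_of_le_one_right hR.le (mem_closedBall_zero_iff.1 hx)
  obtain ⟨x, hx, hfx⟩ := exists_fixedPoint_of_continuous
    (g := fun x => R⁻¹ • (G (c + R • x) - c)) (by fun_prop) (fun x hx => by
      rw [mem_closedBall_zero_iff, norm_smul, norm_inv, Real.norm_of_nonneg hR.le,
        inv_mul_le_one₀ hR, ← mem_closedBall_iff_norm, hGg _ (hmem x hx)]
      exact hmaps (hmem x hx))
  refine ⟨c + R • x, hmem x hx, ?_⟩
  rw [← hGg _ (hmem x hx)]
  have h : G (c + R • x) - c = R • x := (inv_smul_eq_iff₀ hR.ne').1 hfx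
  exact (sub_eq_iff_eq_add'.1 h)

end Brouwer

section Caratheodory

variable {E : Type*} [NormedAddCommGroup E]

/-- The Carathéodory conditions on `[0, T] × K`, with a fixed integrable bound `G`. -/
structure IsCaratheodoryOn (h : ℝ → E → E) (G : ℝ → ℝ) (T : ℝ) (K : Set E) : Prop where
  continuousOn : ∀ᵐ t ∂(volume.restrict (Icc (0 : ℝ) T)), ContinuousOn (h t) K
  aestronglyMeasurable : ∀ x ∈ K,
    AEStronglyMeasurable (fun t => h t x) (volume.restrict (Icc (0 : ℝ) T))
  norm_le : ∀ᵐ t ∂(volume.restrict (Icc (0 : ℝ) T)), ∀ x ∈ K, ‖h t x‖ ≤ G t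
  integrableOn : IntegrableOn G (Icc (0 : ℝ) T)

theorem MeasureTheory.IntegrableOn.intervalIntegrable_of_mem_Icc {F : Type*} [NormedAddCommGroup F]
    {g : ℝ → F} {a b u v : ℝ} (hg : IntegrableOn g (Icc a b)) (hu : u ∈ Icc a b)
    (hv : v ∈ Icc a b) : IntervalIntegrable g volume u v :=
  (hg.mono_set (uIcc_subset_Icc hu hv)).intervalIntegrable

theorem Set.uIoc_subset_Icc_of_mem {a b u v : ℝ} (hu : u ∈ Icc a b) (hv : v ∈ Icc a b) :
    uIoc u v ⊆ Icc a b :=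
  uIoc_subset_uIcc.trans (uIcc_subset_Icc hu hv)

namespace IsCaratheodoryOn

variable {h : ℝ → E → E} {G : ℝ → ℝ} {T : ℝ} {K : Set E}

theorem nonneg (hh : IsCaratheodoryOn h G T K) (hK : K.Nonempty) :
    ∀ᵐ t ∂(volume.restrict (Icc (0 : ℝ) T)), 0 ≤ G t := by
  obtain ⟨x, hx⟩ := hK
  filter_upwards [hh.norm_le] with t ht using (norm_nonneg _).trans (ht x hx)

theorem norm_comp_le (hh : IsCaratheodoryOn h G T K) {y : ℝ → E}
    (hy : ∀ s ∈ Icc 0 T, y s ∈ K) :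
    ∀ᵐ s ∂(volume.restrict (Icc (0 : ℝ) T)), ‖h s (y s)‖ ≤ G s := by
  filter_upwards [hh.norm_le, ae_restrict_mem measurableSet_Icc] with s hs hsm
    using hs _ (hy s hsm)

theorem integrableOn_comp (hh : IsCaratheodoryOn h G T K) {y : ℝ → E}
    (hy : ∀ s ∈ Icc 0 T, y s ∈ K)
    (hm : AEStronglyMeasurable (fun s => h s (y s)) (volume.restrict (Icc 0 T))) :
    IntegrableOn (fun s => h s (y s)) (Icc 0 T) :=
  Integrable.mono' hh.integrableOn hm (hh.norm_comp_le hy)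

theorem integral_bound_mono (hh : IsCaratheodoryOn h G T K) (hK : K.Nonempty) {a b : ℝ}
    (ha : a ∈ Icc 0 T) (hb : b ∈ Icc 0 T) : |∫ s in a..b, G s| ≤ ∫ s in (0 : ℝ)..T, G s := by
  have hT : 0 ≤ T := ha.1.trans ha.2
  have h0 : (0 : ℝ) ∈ Icc 0 T := left_mem_Icc.2 hT
  have hT' : T ∈ Icc 0 T := right_mem_Icc.2 hT
  rw [intervalIntegral.integral_of_le hT, intervalIntegral.abs_intervalIntegral_eq]
  have hnn := hh.nonneg hK
  have hsub : uIoc a b ⊆ Ioc 0 T := by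
    rw [← uIoc_of_le hT]
    exact uIoc_subset_uIoc_of_uIcc_subset_uIcc (uIcc_of_le hT ▸ uIcc_subset_Icc ha hb)
  rw [abs_of_nonneg (integral_nonneg_of_ae
    (ae_restrict_of_ae_restrict_of_subset (uIoc_subset_Icc_of_mem ha hb) hnn))]
  exact setIntegral_mono_set (hh.integrableOn.mono_set Ioc_subset_Icc_self)
    (ae_restrict_of_ae_restrict_of_subset Ioc_subset_Icc_self hnn) (Eventually.of_forall hsub)

theorem aestronglyMeasurable_comp_of_tendsto (hh : IsCaratheodoryOn h G T K) {y : ℕ → ℝ → E}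
    {x : ℝ → E}
    (hm : ∀ k, AEStronglyMeasurable (fun s => h s (y k s)) (volume.restrict (Icc 0 T)))
    (hy : ∀ k, ∀ s ∈ Icc 0 T, y k s ∈ K) (hx : ∀ s ∈ Icc 0 T, x s ∈ K)
    (hlim : ∀ s ∈ Icc 0 T, Tendsto (fun k => y k s) atTop (𝓝 (x s))) :
    (∀ᵐ s ∂(volume.restrict (Icc (0 : ℝ) T)),
      Tendsto (fun k => h s (y k s)) atTop (𝓝 (h s (x s)))) ∧
    AEStronglyMeasurable (fun s => h s (x s)) (volume.restrict (Icc 0 T)) := by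
  have hae : ∀ᵐ s ∂(volume.restrict (Icc (0 : ℝ) T)),
      Tendsto (fun k => h s (y k s)) atTop (𝓝 (h s (x s))) := by
    filter_upwards [hh.continuousOn, ae_restrict_mem measurableSet_Icc] with s hs hsm
    exact (hs _ (hx s hsm)).tendsto.comp (tendsto_nhdsWithin_iff.2
      ⟨hlim s hsm, Eventually.of_forall fun k => hy k s hsm⟩)
  exact ⟨hae, aestronglyMeasurable_of_tendsto_ae atTop hm hae⟩

theorem aestronglyMeasurable_comp_of_countable_range (hh : IsCaratheodoryOn h G T K)
    {q : ℝ → ℕ} (hq : Measurable q) {x : ℕ → E} (hx : ∀ s ∈ Icc 0 T, x (q s) ∈ K) :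
    AEStronglyMeasurable (fun s => h s (x (q s))) (volume.restrict (Icc 0 T)) := by
  have hun : (⋃ j, q ⁻¹' {j}) = univ := by
    ext s; simp
  rw [← Measure.restrict_univ (μ := volume.restrict (Icc 0 T)), ← hun,
    aestronglyMeasurable_iUnion_iff]
  intro j
  have hms : MeasurableSet (q ⁻¹' {j}) := hq (measurableSet_singleton j)
  by_cases hj : ∃ s ∈ Icc 0 T, q s = j
  · obtain ⟨s, hs, rfl⟩ := hj
    refine ((hh.aestronglyMeasurable _ (hx s hs)).mono_measure Measure.restrict_le_self).congr ?_
    filter_upwards [ae_restrict_mem hms] with t ht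
    rw [show q t = q s from ht]
  · push Not at hj
    rw [Measure.restrict_restrict hms, disjoint_iff_inter_eq_empty.1, Measure.restrict_empty]
    · exact aestronglyMeasurable_zero_measure _
    · exact disjoint_left.2 fun s hs hsI => hj s hsI hs

variable [NormedSpace ℝ E]

theorem norm_integral_comp_le (hh : IsCaratheodoryOn h G T K) {y : ℝ → E}
    (hy : ∀ s ∈ Icc 0 T, y s ∈ K) {a b : ℝ} (ha : a ∈ Icc 0 T) (hb : b ∈ Icc 0 T) :
    ‖∫ s in a..b, h s (y s)‖ ≤ |∫ s in a..b, G s| :=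
  intervalIntegral.norm_integral_le_abs_of_norm_le
    (ae_restrict_of_ae_restrict_of_subset (uIoc_subset_Icc_of_mem ha hb) (hh.norm_comp_le hy))
    (hh.integrableOn.intervalIntegrable_of_mem_Icc ha hb)

theorem tendsto_integral_comp (hh : IsCaratheodoryOn h G T K) {y : ℕ → ℝ → E} {x : ℝ → E}
    (hm : ∀ k, AEStronglyMeasurable (fun s => h s (y k s)) (volume.restrict (Icc 0 T)))
    (hy : ∀ k, ∀ s ∈ Icc 0 T, y k s ∈ K) (hx : ∀ s ∈ Icc 0 T, x s ∈ K)
    (hlim : ∀ s ∈ Icc 0 T, Tendsto (fun k => y k s) atTop (𝓝 (x s))) {a b : ℝ}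
    (ha : a ∈ Icc 0 T) (hb : b ∈ Icc 0 T) :
    Tendsto (fun k => ∫ s in a..b, h s (y k s)) atTop (𝓝 (∫ s in a..b, h s (x s))) := by
  have hsub := uIoc_subset_Icc_of_mem ha hb
  refine intervalIntegral.tendsto_integral_filter_of_dominated_convergence G
    (Eventually.of_forall fun k => (hm k).mono_measure (Measure.restrict_mono hsub le_rfl))
    (Eventually.of_forall fun k => ?_) (hh.integrableOn.intervalIntegrable_of_mem_Icc ha hb) ?_
  · rw [← ae_restrict_iff' measurableSet_uIoc]
    exact ae_restrict_of_ae_restrict_of_subset hsub (hh.norm_comp_le (hy k))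
  · rw [← ae_restrict_iff' measurableSet_uIoc]
    exact ae_restrict_of_ae_restrict_of_subset hsub
      (hh.aestronglyMeasurable_comp_of_tendsto hm hy hx hlim).1

theorem continuousOn_integral (hh : IsCaratheodoryOn h G T K) {a b : ℝ}
    (ha : a ∈ Icc 0 T) (hb : b ∈ Icc 0 T) :
    ContinuousOn (fun x => ∫ s in a..b, h s x) K := by
  have hsub := uIoc_subset_Icc_of_mem ha hb
  intro x hx
  refine intervalIntegral.continuousWithinAt_of_dominated_interval (bound := G) ?_ ?_
    (hh.integrableOn.intervalIntegrable_of_mem_Icc ha hb) ?_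
  · filter_upwards [self_mem_nhdsWithin] with y hy
    exact (hh.aestronglyMeasurable y hy).mono_measure (Measure.restrict_mono hsub le_rfl)
  · filter_upwards [self_mem_nhdsWithin] with y hy
    rw [← ae_restrict_iff' measurableSet_uIoc]
    exact ae_restrict_of_ae_restrict_of_subset hsub (hh.norm_comp_le fun _ _ => hy)
  · rw [← ae_restrict_iff' measurableSet_uIoc]
    filter_upwards [ae_restrict_of_ae_restrict_of_subset hsub hh.continuousOn] with t ht
      using ht x hx

end IsCaratheodoryOn

end Caratheodory

section Euler

variable {E : Type*} [NormedAddCommGroup E] [NormedSpace ℝ E]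

/-- The nodes of the Euler scheme with step size `w` for `x' = h(t, x)`, `x(0) = z`, where the time
integral of `h` over each step is computed exactly. -/
noncomputable def eulerNode (h : ℝ → E → E) (w : ℝ) (z : E) : ℕ → E
  | 0 => z
  | j + 1 => eulerNode h w z j + ∫ s in (j * w)..((j + 1 : ℕ) * w), h s (eulerNode h w z j)

/-- The piecewise constant interpolation of the Euler nodes. -/
noncomputable def eulerStep (h : ℝ → E → E) (w : ℝ) (z : E) (s : ℝ) : E :=
  eulerNode h w z ⌊s / w⌋₊

namespace IsCaratheodoryOn

variable {h : ℝ → E → E} {G : ℝ → ℝ} {T : ℝ} {K : Set E} {w δ : ℝ} {N : ℕ} {z : E}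

theorem mul_mem_Icc (hw : 0 < w) (hN : N * w = T) {j : ℕ} (hj : j ≤ N) :
    (j * w : ℝ) ∈ Icc 0 T :=
  ⟨by positivity, hN ▸ mul_le_mul_of_nonneg_right (by exact_mod_cast hj) hw.le⟩

theorem floor_div_le (hw : 0 < w) (hN : N * w = T) {s : ℝ} (hs : s ∈ Icc 0 T) :
    ⌊s / w⌋₊ ≤ N := by
  have h1 : s / w ≤ N := (div_le_iff₀ hw).2 (hN ▸ hs.2)
  exact_mod_cast (Nat.floor_le (div_nonneg hs.1 hw.le)).trans h1

theorem norm_eulerNode_sub_le (hh : IsCaratheodoryOn h G T K) (hw : 0 < w) (hN : N * w = T)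
    (hδ : 0 ≤ δ) (hz : closedBall z δ ⊆ K) (hG : ∫ s in (0 : ℝ)..T, G s ≤ δ) {j : ℕ} (hj : j ≤ N) :
    ‖eulerNode h w z j - z‖ ≤ ∫ s in (0 : ℝ)..T, G s := by
  have hKne : K.Nonempty := ⟨z, hz (mem_closedBall_self hδ)⟩
  have hT : (0 : ℝ) ≤ T := by rw [← hN]; positivity
  have h0 : (0 : ℝ) ∈ Icc 0 T := left_mem_Icc.2 hT
  suffices hs : ‖eulerNode h w z j - z‖ ≤ ∫ s in (0 : ℝ)..(j * w), G s from
    hs.trans ((le_abs_self _).trans (hh.integral_bound_mono hKne h0 (mul_mem_Icc hw hN hj)))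
  induction j with
  | zero => simp [eulerNode]
  | succ j ih =>
    have hj' : j ≤ N := by omega
    have ha := mul_mem_Icc hw hN hj'
    have hb := mul_mem_Icc hw hN hj
    have hab : (j * w : ℝ) ≤ (j + 1 : ℕ) * w :=
      mul_le_mul_of_nonneg_right (by exact_mod_cast j.le_succ) hw.le
    have hmem : eulerNode h w z j ∈ K := hz (mem_closedBall_iff_norm.2 ((ih hj').trans
      ((le_abs_self _).trans ((hh.integral_bound_mono hKne h0 ha).trans hG))))
    have hnn : 0 ≤ ∫ s in (j * w : ℝ)..((j + 1 : ℕ) * w), G s :=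
      intervalIntegral.integral_nonneg_of_ae_restrict hab
        (ae_restrict_of_ae_restrict_of_subset (Icc_subset_Icc ha.1 hb.2) (hh.nonneg hKne))
    have hstep := hh.norm_integral_comp_le (y := fun _ => eulerNode h w z j)
      (fun _ _ => hmem) ha hb
    rw [abs_of_nonneg hnn] at hstep
    rw [← intervalIntegral.integral_add_adjacent_intervals
      (hh.integrableOn.intervalIntegrable_of_mem_Icc h0 ha)
      (hh.integrableOn.intervalIntegrable_of_mem_Icc ha hb), eulerNode, add_sub_right_comm]
    exact (norm_add_le _ _).trans (add_le_add (ih hj') hstep)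

theorem eulerNode_mem (hh : IsCaratheodoryOn h G T K) (hw : 0 < w) (hN : N * w = T)
    (hδ : 0 ≤ δ) (hz : closedBall z δ ⊆ K) (hG : ∫ s in (0 : ℝ)..T, G s ≤ δ) {j : ℕ}
    (hj : j ≤ N) : eulerNode h w z j ∈ K :=
  hz (mem_closedBall_iff_norm.2 ((hh.norm_eulerNode_sub_le hw hN hδ hz hG hj).trans hG))

theorem eulerStep_mem (hh : IsCaratheodoryOn h G T K) (hw : 0 < w) (hN : N * w = T)
    (hδ : 0 ≤ δ) (hz : closedBall z δ ⊆ K) (hG : ∫ s in (0 : ℝ)..T, G s ≤ δ) {s : ℝ}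
    (hs : s ∈ Icc 0 T) : eulerStep h w z s ∈ K :=
  hh.eulerNode_mem hw hN hδ hz hG (floor_div_le hw hN hs)

theorem aestronglyMeasurable_eulerStep (hh : IsCaratheodoryOn h G T K) (hw : 0 < w)
    (hN : N * w = T) (hδ : 0 ≤ δ) (hz : closedBall z δ ⊆ K)
    (hG : ∫ s in (0 : ℝ)..T, G s ≤ δ) :
    AEStronglyMeasurable (fun s => h s (eulerStep h w z s)) (volume.restrict (Icc 0 T)) :=
  hh.aestronglyMeasurable_comp_of_countable_range
    (Nat.measurable_floor.comp (measurable_id.div_const w))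
    fun _ hs => hh.eulerStep_mem hw hN hδ hz hG hs

theorem continuousOn_eulerNode (hh : IsCaratheodoryOn h G T K) (hw : 0 < w) (hN : N * w = T)
    (hδ : 0 ≤ δ) {S : Set E} (hS : ∀ z ∈ S, closedBall z δ ⊆ K)
    (hG : ∫ s in (0 : ℝ)..T, G s ≤ δ) {j : ℕ} (hj : j ≤ N) :
    ContinuousOn (fun z => eulerNode h w z j) S := by
  induction j with
  | zero => exact continuousOn_id
  | succ j ih =>
    have hj' : j ≤ N := by omega
    exact (ih hj').add ((hh.continuousOn_integral (mul_mem_Icc hw hN hj')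
      (mul_mem_Icc hw hN hj)).comp (ih hj') fun z hz =>
        hh.eulerNode_mem hw hN hδ (hS z hz) hG hj')

theorem integral_eulerStep (hh : IsCaratheodoryOn h G T K) (hw : 0 < w) (hN : N * w = T)
    (hδ : 0 ≤ δ) (hz : closedBall z δ ⊆ K) (hG : ∫ s in (0 : ℝ)..T, G s ≤ δ) {j : ℕ}
    (hj : j ≤ N) : ∫ s in (0 : ℝ)..(j * w), h s (eulerStep h w z s) = eulerNode h w z j - z := by
  have hT : (0 : ℝ) ≤ T := by rw [← hN]; positivity
  have hintegr := hh.integrableOn_comp (fun _ hs => hh.eulerStep_mem hw hN hδ hz hG hs)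
    (hh.aestronglyMeasurable_eulerStep hw hN hδ hz hG)
  induction j with
  | zero => simp [eulerNode]
  | succ j ih =>
    have hj' : j ≤ N := by omega
    have ha := mul_mem_Icc hw hN hj'
    have hb := mul_mem_Icc hw hN hj
    have hab : (j * w : ℝ) ≤ (j + 1 : ℕ) * w :=
      mul_le_mul_of_nonneg_right (by exact_mod_cast j.le_succ) hw.le
    rw [← intervalIntegral.integral_add_adjacent_intervals
      (hintegr.intervalIntegrable_of_mem_Icc (left_mem_Icc.2 hT) ha)
      (hintegr.intervalIntegrable_of_mem_Icc ha hb), ih hj', eulerNode, add_sub_right_comm]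
    congr 1
    refine intervalIntegral.integral_congr_Ioo_of_le hab fun s hs => ?_
    have hfl : ⌊s / w⌋₊ = j := by
      rw [Nat.floor_eq_iff (div_nonneg (ha.1.trans hs.1.le) hw.le), le_div_iff₀ hw,
        div_lt_iff₀ hw]
      exact ⟨hs.1.le, by exact_mod_cast hs.2⟩
    simp only [eulerStep, hfl]

theorem norm_eulerStep_sub_le (hh : IsCaratheodoryOn h G T K) (hw : 0 < w) (hN : N * w = T)
    (hδ : 0 ≤ δ) (hz : closedBall z δ ⊆ K) (hG : ∫ s in (0 : ℝ)..T, G s ≤ δ) {t : ℝ}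
    (ht : t ∈ Icc 0 T) :
    ‖eulerStep h w z t - (z + ∫ s in (0 : ℝ)..t, h s (eulerStep h w z s))‖ ≤
      |∫ s in t..(⌊t / w⌋₊ * w), G s| := by
  have hmem : ∀ s ∈ Icc 0 T, eulerStep h w z s ∈ K := fun _ hs =>
    hh.eulerStep_mem hw hN hδ hz hG hs
  have hintegr := hh.integrableOn_comp hmem (hh.aestronglyMeasurable_eulerStep hw hN hδ hz hG)
  have hj := floor_div_le hw hN ht
  have h0 : (0 : ℝ) ∈ Icc 0 T := left_mem_Icc.2 (ht.1.trans ht.2)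
  have hb := mul_mem_Icc hw hN hj
  have hnode : eulerStep h w z t - (z + ∫ s in (0 : ℝ)..t, h s (eulerStep h w z s)) =
      ∫ s in t..(⌊t / w⌋₊ * w), h s (eulerStep h w z s) := by
    rw [← intervalIntegral.integral_interval_sub_left (hintegr.intervalIntegrable_of_mem_Icc h0 hb)
      (hintegr.intervalIntegrable_of_mem_Icc h0 ht), hh.integral_eulerStep hw hN hδ hz hG hj,
      sub_add_eq_sub_sub]
    rfl
  rw [hnode]
  exact hh.norm_integral_comp_le hmem ht hb

/-- Approximate solutions of `x' = h(t, x)` on `[0, T]` with values in a compact set subconverge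
to a solution. -/
theorem exists_solution_of_approx (hh : IsCaratheodoryOn h G T K) (hT : 0 ≤ T) (hK : IsCompact K)
    {y : ℕ → ℝ → E} {z : ℕ → E}
    (hm : ∀ k, AEStronglyMeasurable (fun s => h s (y k s)) (volume.restrict (Icc 0 T)))
    (hy : ∀ k, ∀ s ∈ Icc 0 T, y k s ∈ K)
    (hmem : ∀ k, ∀ t ∈ Icc 0 T, (z k + ∫ s in (0 : ℝ)..t, h s (y k s)) ∈ K)
    (happrox : ∀ t ∈ Icc 0 T, Tendsto
      (fun k => y k t - (z k + ∫ s in (0 : ℝ)..t, h s (y k s))) atTop (𝓝 0))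
    (hper : ∀ k, ∫ s in (0 : ℝ)..T, h s (y k s) = 0) :
    ∃ x : ℝ → E, (∀ t ∈ Icc 0 T, x t ∈ K) ∧
      AEStronglyMeasurable (fun s => h s (x s)) (volume.restrict (Icc 0 T)) ∧
      (∀ t ∈ Icc 0 T, x t = x 0 + ∫ s in (0 : ℝ)..t, h s (x s)) ∧
      ∫ s in (0 : ℝ)..T, h s (x s) = 0 := by
  have h0 : (0 : ℝ) ∈ Icc 0 T := left_mem_Icc.2 hT
  have hT' : T ∈ Icc 0 T := right_mem_Icc.2 hT
  have hintegr : ∀ k, IntegrableOn (fun s => h s (y k s)) (Icc 0 T) := fun k =>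
    hh.integrableOn_comp (hy k) (hm k)
  have hcont : ∀ k, Continuous fun t : Icc (0 : ℝ) T =>
      z k + ∫ s in (0 : ℝ)..t, h s (y k s) := by
    intro k
    have hprim := intervalIntegral.continuousOn_primitive_interval
      (show IntegrableOn (fun s => h s (y k s)) (uIcc 0 T) by rw [uIcc_of_le hT]; exact hintegr k)
    rw [uIcc_of_le hT] at hprim
    exact continuous_const.add (continuousOn_iff_continuous_domRestrict.1 hprim)
  let F : ℕ → BoundedContinuousFunction (Icc (0 : ℝ) T) E := fun k =>
    BoundedContinuousFunction.mkOfCompact ⟨_, hcont k⟩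
  have hcpt : IsCompact (closure (range F)) := by
    refine BoundedContinuousFunction.arzela_ascoli K hK _ ?_ ?_
    · rintro _ t ⟨k, rfl⟩
      exact hmem k t t.2
    · intro t₀
      refine Metric.equicontinuousAt_of_continuity_modulus
        (fun t : Icc (0 : ℝ) T => |∫ s in (t₀ : ℝ)..t, G s|) ?_ _ (Eventually.of_forall ?_)
      · have hc := intervalIntegral.continuousOn_primitive_interval'
          (hh.integrableOn.intervalIntegrable_of_mem_Icc h0 hT')
          (show (t₀ : ℝ) ∈ uIcc 0 T by rw [uIcc_of_le hT]; exact t₀.2)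
        rw [uIcc_of_le hT] at hc
        have h1 := (continuousOn_iff_continuous_domRestrict.1 hc).abs.tendsto t₀
        simpa [Set.domRestrict] using h1
      · rintro t ⟨_, k, rfl⟩
        have h2 : (F k) t - (F k) t₀ = ∫ s in (t₀ : ℝ)..t, h s (y k s) := by
          rw [← intervalIntegral.integral_interval_sub_left
            ((hintegr k).intervalIntegrable_of_mem_Icc h0 t.2)
            ((hintegr k).intervalIntegrable_of_mem_Icc h0 t₀.2)]
          simp [F]
        rw [dist_comm, dist_eq_norm]
        change ‖(F k) t - (F k) t₀‖ ≤ _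
        rw [h2]
        exact hh.norm_integral_comp_le (hy k) t₀.2 t.2
  obtain ⟨X, -, φ, hφ, hX⟩ := hcpt.tendsto_subseq fun k =>
    subset_closure (mem_range_self (f := F) k)
  have hpt : ∀ t : Icc (0 : ℝ) T, Tendsto
      (fun k => z (φ k) + ∫ s in (0 : ℝ)..t, h s (y (φ k) s)) atTop (𝓝 (X t)) := fun t =>
    ((BoundedContinuousFunction.lipschitz_eval_const t).continuous.tendsto X).comp hX
  let x : ℝ → E := fun t => X (projIcc 0 T hT t)
  have hxX : ∀ t (ht : t ∈ Icc 0 T), x t = X ⟨t, ht⟩ := fun t ht => by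
    simp only [x, projIcc_of_mem hT ht]
  have hXt : ∀ t ∈ Icc 0 T, Tendsto
      (fun k => z (φ k) + ∫ s in (0 : ℝ)..t, h s (y (φ k) s)) atTop (𝓝 (x t)) := fun t ht => by
    rw [hxX t ht]; exact hpt ⟨t, ht⟩
  have hyx : ∀ t ∈ Icc 0 T, Tendsto (fun k => y (φ k) t) atTop (𝓝 (x t)) := fun t ht => by
    simpa using ((happrox t ht).comp hφ.tendsto_atTop).add (hXt t ht)
  have hxK : ∀ t ∈ Icc 0 T, x t ∈ K := fun t ht =>
    hK.isClosed.mem_of_tendsto (hyx t ht) (Eventually.of_forall fun k => hy _ t ht)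
  have hlim : ∀ t ∈ Icc 0 T, Tendsto (fun k => ∫ s in (0 : ℝ)..t, h s (y (φ k) s)) atTop
      (𝓝 (∫ s in (0 : ℝ)..t, h s (x s))) := fun t ht =>
    hh.tendsto_integral_comp (fun k => hm (φ k)) (fun k => hy (φ k)) hxK hyx h0 ht
  have hz : Tendsto (fun k => z (φ k)) atTop (𝓝 (x 0)) := by simpa using hXt 0 h0
  refine ⟨x, hxK, (hh.aestronglyMeasurable_comp_of_tendsto (fun k => hm (φ k))
    (fun k => hy (φ k)) hxK hyx).2, fun t ht => ?_, ?_⟩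
  · exact tendsto_nhds_unique (hXt t ht) (hz.add (hlim t ht))
  · exact tendsto_nhds_unique (hlim T hT') (by simp [hper])

end IsCaratheodoryOn

end Euler

section Periodic

variable {E : Type*} [NormedAddCommGroup E]

theorem tendsto_floor_div_mul {w : ℕ → ℝ} (hw : ∀ k, 0 < w k) (hw0 : Tendsto w atTop (𝓝 0))
    {t : ℝ} (ht : 0 ≤ t) : Tendsto (fun k => (⌊t / w k⌋₊ * w k : ℝ)) atTop (𝓝 t) := by
  refine tendsto_of_tendsto_of_tendsto_of_le_of_le (g := fun k => t - w k)
    (by simpa using tendsto_const_nhds.sub hw0) tendsto_const_nhds (fun k => ?_) fun k => ?_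
  · have h1 := (div_lt_iff₀ (hw k)).1 (Nat.lt_floor_add_one (t / w k))
    change t - w k ≤ _
    linarith
  · exact (le_div_iff₀ (hw k)).1 (Nat.floor_le (div_nonneg ht (hw k).le))

variable [InnerProductSpace ℝ E] [FiniteDimensional ℝ E]

namespace IsCaratheodoryOn

variable {h : ℝ → E → E} {G : ℝ → ℝ} {T δ w : ℝ} {N : ℕ} {z₀ : E}

theorem exists_eulerNode_eq (hh : IsCaratheodoryOn h G T (closedBall z₀ (2 * δ)))
    (hw : 0 < w) (hN : N * w = T) (hδ : 0 < δ) (hG : ∫ s in (0 : ℝ)..T, G s ≤ δ) {L : E →L[ℝ] E}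
    (hL : Function.Injective L)
    (hclose : ∀ z ∈ closedBall z₀ δ, ∀ y : ℝ → E,
      (∀ s ∈ Icc 0 T, y s ∈ closedBall z₀ (2 * δ)) →
      AEStronglyMeasurable (fun s => h s (y s)) (volume.restrict (Icc 0 T)) →
      (∀ s ∈ Icc 0 T, ‖y s - z‖ ≤ ∫ s in (0 : ℝ)..T, G s) →
      ‖L (∫ s in (0 : ℝ)..T, h s (y s)) - (z - z₀)‖ ≤ δ) :
    ∃ z ∈ closedBall z₀ δ, ∫ s in (0 : ℝ)..T, h s (eulerStep h w z s) = 0 := by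
  have hball : ∀ z ∈ closedBall z₀ δ, closedBall z δ ⊆ closedBall z₀ (2 * δ) := fun z hz =>
    closedBall_subset_closedBall' (by rw [mem_closedBall] at hz; linarith)
  have hintegr : ∀ z ∈ closedBall z₀ δ,
      ∫ s in (0 : ℝ)..T, h s (eulerStep h w z s) = eulerNode h w z N - z := fun z hz => by
    rw [← hh.integral_eulerStep hw hN hδ.le (hball z hz) hG le_rfl, hN]
  obtain ⟨z, hz, hfix⟩ := exists_fixedPoint_of_mapsTo_closedBall
    (g := fun z => z - L (eulerNode h w z N - z)) hδ
    (continuousOn_id.sub (L.continuous.comp_continuousOn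
      ((hh.continuousOn_eulerNode hw hN hδ.le hball hG le_rfl).sub continuousOn_id)))
    (fun z hz => by
      have hc := hclose z hz (eulerStep h w z)
        (fun s hs => hh.eulerStep_mem hw hN hδ.le (hball z hz) hG hs)
        (hh.aestronglyMeasurable_eulerStep hw hN hδ.le (hball z hz) hG)
        (fun s hs => hh.norm_eulerNode_sub_le hw hN hδ.le (hball z hz) hG
          (floor_div_le hw hN hs))
      rw [hintegr z hz, norm_sub_rev, sub_right_comm] at hc
      exact mem_closedBall_iff_norm.2 hc)
  refine ⟨z, hz, ?_⟩
  rw [hintegr z hz]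
  exact (map_eq_zero_iff L hL).1 (sub_eq_self.1 hfix)

/-- If the mean of `h` along curves that stay near their starting point `z` is close enough to
`L⁻¹ (z - z₀)`, then `x' = h(t, x)` has a solution on `[0, T]` with `x(0) = x(T)`. -/
theorem exists_periodic_solution (hh : IsCaratheodoryOn h G T (closedBall z₀ (2 * δ)))
    (hT : 0 < T) (hδ : 0 < δ) (hG : ∫ s in (0 : ℝ)..T, G s ≤ δ) {L : E →L[ℝ] E}
    (hL : Function.Injective L)
    (hclose : ∀ z ∈ closedBall z₀ δ, ∀ y : ℝ → E,
      (∀ s ∈ Icc 0 T, y s ∈ closedBall z₀ (2 * δ)) →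
      AEStronglyMeasurable (fun s => h s (y s)) (volume.restrict (Icc 0 T)) →
      (∀ s ∈ Icc 0 T, ‖y s - z‖ ≤ ∫ s in (0 : ℝ)..T, G s) →
      ‖L (∫ s in (0 : ℝ)..T, h s (y s)) - (z - z₀)‖ ≤ δ) :
    ∃ x : ℝ → E, (∀ t ∈ Icc 0 T, x t ∈ closedBall z₀ (2 * δ)) ∧
      AEStronglyMeasurable (fun s => h s (x s)) (volume.restrict (Icc 0 T)) ∧
      (∀ t ∈ Icc 0 T, x t = x 0 + ∫ s in (0 : ℝ)..t, h s (x s)) ∧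
      ∫ s in (0 : ℝ)..T, h s (x s) = 0 := by
  have hball : ∀ z ∈ closedBall z₀ δ, closedBall z δ ⊆ closedBall z₀ (2 * δ) := fun z hz =>
    closedBall_subset_closedBall' (by rw [mem_closedBall] at hz; linarith)
  have hne : (closedBall z₀ (2 * δ)).Nonempty := ⟨z₀, mem_closedBall_self (by linarith)⟩
  have h0 : (0 : ℝ) ∈ Icc 0 T := left_mem_Icc.2 hT.le
  let w : ℕ → ℝ := fun k => T / (k + 1)
  have hw : ∀ k, 0 < w k := fun k => by positivity
  have hN : ∀ k, ((k + 1 : ℕ) * w k : ℝ) = T := fun k => by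
    simp only [w]; push_cast; field_simp
  have hw0 : Tendsto w atTop (𝓝 0) := by
    simpa [w, div_eq_mul_inv] using (tendsto_one_div_add_atTop_nhds_zero_nat (𝕜 := ℝ)).const_mul T
  choose z hz hz0 using fun k => hh.exists_eulerNode_eq (hw k) (hN k) hδ hG hL hclose
  have hstep : ∀ k, ∀ s ∈ Icc 0 T, eulerStep h (w k) (z k) s ∈ closedBall z₀ (2 * δ) :=
    fun k s hs => hh.eulerStep_mem (hw k) (hN k) hδ.le (hball _ (hz k)) hG hs
  refine hh.exists_solution_of_approx hT.le (isCompact_closedBall z₀ (2 * δ))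
    (y := fun k => eulerStep h (w k) (z k)) (z := z)
    (fun k => hh.aestronglyMeasurable_eulerStep (hw k) (hN k) hδ.le (hball _ (hz k)) hG)
    hstep (fun k t ht => ?_) (fun t ht => ?_) hz0
  · refine hball _ (hz k) ?_
    rw [mem_closedBall_iff_norm, add_sub_cancel_left]
    exact (hh.norm_integral_comp_le (hstep k) h0 ht).trans
      ((hh.integral_bound_mono hne h0 ht).trans hG)
  · refine squeeze_zero_norm (fun k => hh.norm_eulerStep_sub_le (hw k) (hN k) hδ.le
      (hball _ (hz k)) hG ht) ?_
    have hc := intervalIntegral.continuousOn_primitive_interval'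
      (hh.integrableOn.intervalIntegrable_of_mem_Icc h0 (right_mem_Icc.2 hT.le))
      (show t ∈ uIcc 0 T by rwa [uIcc_of_le hT.le])
    rw [uIcc_of_le hT.le] at hc
    have hlim := (hc t ht).tendsto.comp (tendsto_nhdsWithin_iff.2
      ⟨tendsto_floor_div_mul hw hw0 ht.1, Eventually.of_forall fun k =>
        mul_mem_Icc (hw k) (hN k) (floor_div_le (hw k) (hN k) ht)⟩)
    simpa using hlim.abs

end IsCaratheodoryOn

end Periodic

section Averaging

variable {E : Type*} [NormedAddCommGroup E] [NormedSpace ℝ E]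

/-- Along curves that stay close to a point `z`, the integral of `f(·, ·, ε)` is close to that of
`f(·, z, 0)` for small `ε`, uniformly in `z`. -/
theorem eventually_norm_integral_sub_le {f : ℝ → E → ℝ → E} {g : ℝ → ℝ} {T ε₀ : ℝ} {K : Set E}
    (hT : 0 ≤ T) (hε₀ : 0 < ε₀) (hK : IsCompact K)
    (hcont : ∀ᵐ t ∂(volume.restrict (Icc (0 : ℝ) T)),
      ContinuousOn (fun p : E × ℝ => f t p.1 p.2) (K ×ˢ Icc (0 : ℝ) ε₀))
    (hmeas : ∀ x ∈ K, AEStronglyMeasurable (fun t => f t x 0) (volume.restrict (Icc 0 T)))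
    (hbound : ∀ᵐ t ∂(volume.restrict (Icc (0 : ℝ) T)),
      ∀ x ∈ K, ∀ ε ∈ Icc (0 : ℝ) ε₀, ‖f t x ε‖ ≤ g t)
    (hg : IntegrableOn g (Icc 0 T)) (C : ℝ) {c : ℝ} (hc : 0 < c) :
    ∃ ε₁ ∈ Ioc 0 ε₀, ∀ ε ∈ Icc 0 ε₁, ∀ z ∈ K, ∀ y : ℝ → E, (∀ s ∈ Icc 0 T, y s ∈ K) →
      AEStronglyMeasurable (fun s => f s (y s) ε) (volume.restrict (Icc 0 T)) →
      (∀ s ∈ Icc 0 T, ‖y s - z‖ ≤ ε * C) →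
      ‖(∫ s in (0 : ℝ)..T, f s (y s) ε) - ∫ s in (0 : ℝ)..T, f s z 0‖ ≤ c := by
  by_contra! hcon
  have hpos : ∀ k : ℕ, min ε₀ (1 / ((k : ℝ) + 1)) ∈ Ioc 0 ε₀ := fun k =>
    ⟨lt_min hε₀ (by positivity), min_le_left _ _⟩
  choose ε hε z hz y hy hm hyz hlt using fun k => hcon _ (hpos k)
  have hε0 : Tendsto ε atTop (𝓝 0) := squeeze_zero (fun k => (hε k).1)
    (fun k => (hε k).2.trans (min_le_right _ _)) tendsto_one_div_add_atTop_nhds_zero_nat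
  have hεI : ∀ k, ε k ∈ Icc 0 ε₀ := fun k => ⟨(hε k).1, (hε k).2.trans (min_le_left _ _)⟩
  have h0I : (0 : ℝ) ∈ Icc 0 ε₀ := left_mem_Icc.2 hε₀.le
  have hdist : ∀ s ∈ Icc 0 T, Tendsto (fun k => dist (y k s, ε k) (z k, (0 : ℝ))) atTop (𝓝 0) := by
    intro s hs
    refine squeeze_zero (fun k => dist_nonneg) (g := fun k => max (ε k * C) (ε k)) (fun k => ?_)
      (by simpa using (hε0.mul_const C).max hε0)
    rw [Prod.dist_eq, dist_eq_norm, Real.dist_eq, sub_zero, abs_of_nonneg (hε k).1]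
    exact max_le_max (hyz k s hs) le_rfl
  have hsub : uIoc 0 T ⊆ Icc 0 T := by rw [uIoc_of_le hT]; exact Ioc_subset_Icc_self
  have hlim : Tendsto (fun k => ∫ s in (0 : ℝ)..T, (f s (y k s) (ε k) - f s (z k) 0)) atTop
      (𝓝 (∫ s in (0 : ℝ)..T, (0 : E))) := by
    refine intervalIntegral.tendsto_integral_filter_of_dominated_convergence (fun s => g s + g s)
      (Eventually.of_forall fun k => ((hm k).sub (hmeas _ (hz k))).mono_measure
        (Measure.restrict_mono hsub le_rfl)) (Eventually.of_forall fun k => ?_) ?_ ?_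
    · rw [← ae_restrict_iff' measurableSet_uIoc]
      refine ae_restrict_of_ae_restrict_of_subset hsub ?_
      filter_upwards [hbound, ae_restrict_mem measurableSet_Icc] with s hs hsm
      exact (norm_sub_le _ _).trans
        (add_le_add (hs _ (hy k s hsm) _ (hεI k)) (hs _ (hz k) _ h0I))
    · have := hg.intervalIntegrable_of_mem_Icc (left_mem_Icc.2 hT) (right_mem_Icc.2 hT)
      exact this.add this
    · rw [← ae_restrict_iff' measurableSet_uIoc]
      refine ae_restrict_of_ae_restrict_of_subset hsub ?_
      filter_upwards [hcont, ae_restrict_mem measurableSet_Icc] with s hs hsm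
      have huc := Metric.uniformContinuousOn_iff.1
        ((hK.prod isCompact_Icc).uniformContinuousOn_of_continuous hs)
      rw [Metric.tendsto_atTop]
      intro η hη
      obtain ⟨ρ, hρ, huc⟩ := huc η hη
      obtain ⟨k₀, hk₀⟩ := Metric.tendsto_atTop.1 (hdist s hsm) ρ hρ
      refine ⟨k₀, fun k hk => ?_⟩
      have hd := hk₀ k hk
      rw [Real.dist_eq, sub_zero, abs_of_nonneg dist_nonneg] at hd
      simpa [dist_eq_norm] using huc _ ⟨hy k s hsm, hεI k⟩ _ ⟨hz k, h0I⟩ hd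
  have hintegr : ∀ k, ∫ s in (0 : ℝ)..T, (f s (y k s) (ε k) - f s (z k) 0) =
      (∫ s in (0 : ℝ)..T, f s (y k s) (ε k)) - ∫ s in (0 : ℝ)..T, f s (z k) 0 := by
    intro k
    refine intervalIntegral.integral_sub
      (IntegrableOn.intervalIntegrable_of_mem_Icc (a := 0) (b := T) (hg.mono' (hm k) ?_)
        (left_mem_Icc.2 hT) (right_mem_Icc.2 hT))
      (IntegrableOn.intervalIntegrable_of_mem_Icc (a := 0) (b := T) (hg.mono' (hmeas _ (hz k)) ?_)
        (left_mem_Icc.2 hT) (right_mem_Icc.2 hT))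
    · filter_upwards [hbound, ae_restrict_mem measurableSet_Icc] with s hs hsm
        using hs _ (hy k s hsm) _ (hεI k)
    · filter_upwards [hbound] with s hs using hs _ (hz k) _ h0I
  simp only [hintegr, intervalIntegral.integral_zero] at hlim
  exact (ge_of_tendsto hlim.norm (Eventually.of_forall fun k => (hlt k).le)).not_gt (by simpa)

/-- A nondegenerate zero of a map is, up to an invertible linear map, close to an identity. -/
theorem HasFDerivAt.eventually_norm_symm_sub_le {F : E → E} {A : E ≃L[ℝ] E} {z₀ : E}
    (hF : HasFDerivAt F (A : E →L[ℝ] E) z₀) (h0 : F z₀ = 0) :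
    ∀ᶠ z in 𝓝 z₀, ‖A.symm (F z) - (z - z₀)‖ ≤ ‖z - z₀‖ / 2 := by
  have hpos : 0 < 1 / 2 / (‖(A.symm : E →L[ℝ] E)‖ + 1) := by positivity
  filter_upwards [hF.isLittleO.def hpos] with z hz
  rw [h0, sub_zero] at hz
  have h1 : A.symm (F z) - (z - z₀) = (A.symm : E →L[ℝ] E) (F z - (A : E →L[ℝ] E) (z - z₀)) := by
    simp
  rw [h1]
  calc _ ≤ ‖(A.symm : E →L[ℝ] E)‖ * (1 / 2 / (‖(A.symm : E →L[ℝ] E)‖ + 1) * ‖z - z₀‖) :=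
        ContinuousLinearMap.le_opNorm_of_le _ hz
    _ ≤ (‖(A.symm : E →L[ℝ] E)‖ + 1) *
          (1 / 2 / (‖(A.symm : E →L[ℝ] E)‖ + 1) * ‖z - z₀‖) := by gcongr; linarith
    _ = ‖z - z₀‖ / 2 := by field_simp

end Averaging

section PeriodicSolution

variable {E : Type*} [NormedAddCommGroup E] [NormedSpace ℝ E]

/-- `φ` is an absolutely continuous `T`-periodic solution of `x' = h(t, x)`. -/
structure IsPeriodicSolution (h : ℝ → E → E) (T : ℝ) (φ : ℝ → E) : Prop where
  periodic : ∀ t, φ (t + T) = φ t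
  intervalIntegrable : ∀ u v : ℝ, IntervalIntegrable (fun s => h s (φ s)) volume u v
  sub_eq_integral : ∀ u v : ℝ, φ v - φ u = ∫ s in u..v, h s (φ s)

theorem exists_isPeriodicSolution_extension {h : ℝ → E → E} {T : ℝ} (hT : 0 < T)
    (hper : ∀ t x, h (t + T) x = h t x) {x : ℝ → E}
    (hintegr : IntegrableOn (fun s => h s (x s)) (Icc 0 T))
    (hx : ∀ t ∈ Icc 0 T, x t = x 0 + ∫ s in (0 : ℝ)..t, h s (x s))
    (hx0 : ∫ s in (0 : ℝ)..T, h s (x s) = 0) :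
    ∃ φ, IsPeriodicSolution h T φ ∧ ∀ t, ∃ s ∈ Icc 0 T, φ t = x s := by
  have hmod : ∀ t, toIcoMod hT 0 t ∈ Ico 0 T := fun t => by simpa using toIcoMod_mem_Ico hT 0 t
  let φ : ℝ → E := fun t => x (toIcoMod hT 0 t)
  have hφper : Function.Periodic φ T := fun t => by simp only [φ, toIcoMod_add_right]
  have hφx : ∀ t ∈ Ico 0 T, φ t = x t := fun t ht => by
    simp only [φ, (toIcoMod_eq_self hT).2 (show t ∈ Ico 0 (0 + T) by simpa using ht)]
  have hgper : Function.Periodic (fun s => h s (φ s)) T := fun s => by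
    simp only [hφper s, hper]
  have hgx : ∀ t ∈ Icc 0 T, ∫ s in (0 : ℝ)..t, h s (φ s) = ∫ s in (0 : ℝ)..t, h s (x s) :=
    fun t ht => intervalIntegral.integral_congr_Ioo_of_le ht.1 fun s hs => by
      simp only [hφx s ⟨hs.1.le, hs.2.trans_le ht.2⟩]
  have hgint : ∀ u v : ℝ, IntervalIntegrable (fun s => h s (φ s)) volume u v := by
    refine fun u v => hgper.intervalIntegrable₀ hT.ne' ?_ u v
    have hI := hintegr.intervalIntegrable_of_mem_Icc (left_mem_Icc.2 hT.le) (right_mem_Icc.2 hT.le)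
    rw [intervalIntegrable_iff_integrableOn_Ioo_of_le hT.le] at hI ⊢
    exact hI.congr_fun (fun s hs => by simp only [hφx s ⟨hs.1.le, hs.2⟩]) measurableSet_Ioo
  have hPper : Function.Periodic (fun t => ∫ s in (0 : ℝ)..t, h s (φ s)) T := fun t => by
    beta_reduce
    rw [← intervalIntegral.integral_add_adjacent_intervals (hgint 0 t) (hgint t (t + T)),
      hgper.intervalIntegral_add_eq t 0, zero_add, hgx T (right_mem_Icc.2 hT.le), hx0, add_zero]
  have hφ : ∀ t, φ t = x 0 + ∫ s in (0 : ℝ)..t, h s (φ s) := fun t => by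
    have ht := Ico_subset_Icc_self (hmod t)
    have h1 : (∫ s in (0 : ℝ)..toIcoMod hT 0 t, h s (φ s)) = ∫ s in (0 : ℝ)..t, h s (φ s) :=
      hPper.sub_zsmul_eq (toIcoDiv hT 0 t)
    rw [← h1, hgx _ ht, ← hx _ ht]
  refine ⟨φ, ⟨hφper, hgint, fun u v => ?_⟩, fun t => ⟨_, Ico_subset_Icc_self (hmod t), rfl⟩⟩
  rw [hφ u, hφ v, add_sub_add_left_eq_sub,
    intervalIntegral.integral_interval_sub_left (hgint 0 v) (hgint 0 u)]

end PeriodicSolution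

/-- Diagonal choice: approximate selections of every order give a single selection that is
eventually of every order. -/
theorem exists_forall_eventually_of_antitone {ι α : Type*} [Nonempty α] {l : Filter ι} {b : ι → ℕ}
    (hb : Tendsto b l atTop) {Q : ℕ → ι → α → Prop} (hQ : ∀ i a, Antitone fun n => Q n i a)
    (hex : ∀ n, ∀ᶠ i in l, ∃ a, Q n i a) : ∃ φ : ι → α, ∀ n, ∀ᶠ i in l, Q n i (φ i) := by
  classical
  let m : ι → ℕ := fun i => Nat.findGreatest (fun n => ∃ a, Q n i a) (b i)
  refine ⟨fun i => Classical.epsilon fun a => Q (m i) i a, fun n => ?_⟩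
  filter_upwards [hex n, hb.eventually_ge_atTop n] with i hi hbi
  have hm : ∃ a, Q (m i) i a := Nat.findGreatest_spec (P := fun n => ∃ a, Q n i a) hbi hi
  exact hQ i _ (Nat.le_findGreatest hbi hi) (Classical.epsilon_spec hm)

section Existence

variable {E : Type*} [NormedAddCommGroup E] [InnerProductSpace ℝ E] [FiniteDimensional ℝ E]

theorem eventually_exists_isPeriodicSolution {f : ℝ → E → ℝ → E} {g : ℝ → ℝ} {T ε₀ δ : ℝ} {z₀ : E}
    (hT : 0 < T) (hε₀ : 0 < ε₀) (hδ : 0 < δ) (hper : ∀ t x ε, f (t + T) x ε = f t x ε)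
    (hcont : ∀ᵐ t ∂(volume.restrict (Icc (0 : ℝ) T)), ContinuousOn
      (fun p : E × ℝ => f t p.1 p.2) (closedBall z₀ (2 * δ) ×ˢ Icc (0 : ℝ) ε₀))
    (hmeas : ∀ x ∈ closedBall z₀ (2 * δ), ∀ ε ∈ Icc 0 ε₀,
      AEStronglyMeasurable (fun t => f t x ε) (volume.restrict (Icc 0 T)))
    (hbound : ∀ᵐ t ∂(volume.restrict (Icc (0 : ℝ) T)),
      ∀ x ∈ closedBall z₀ (2 * δ), ∀ ε ∈ Icc (0 : ℝ) ε₀, ‖f t x ε‖ ≤ g t)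
    (hg : IntegrableOn g (Icc 0 T)) {L : E →L[ℝ] E} (hL : Function.Injective L)
    (hLf : ∀ z ∈ closedBall z₀ δ, ‖L (∫ s in (0 : ℝ)..T, f s z 0) - (z - z₀)‖ ≤ δ / 2) :
    ∀ᶠ ε in 𝓝[>] (0 : ℝ), ∃ φ, IsPeriodicSolution (fun s x => ε • f s x ε) T φ ∧
      ∀ t, φ t ∈ closedBall z₀ (2 * δ) := by
  have hc : 0 < δ / 2 / (‖L‖ + 1) := by positivity
  obtain ⟨ε₁, hε₁, hclose⟩ := eventually_norm_integral_sub_le hT.le hε₀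
    (isCompact_closedBall z₀ (2 * δ)) hcont
    (fun x hx => hmeas x hx 0 (left_mem_Icc.2 hε₀.le)) hbound hg (∫ s in (0 : ℝ)..T, g s) hc
  have hsmall : ∀ᶠ ε in 𝓝[>] (0 : ℝ), ε * (∫ s in (0 : ℝ)..T, g s) < δ :=
    ((continuous_mul_const _).tendsto' 0 0 (zero_mul _)).mono_left nhdsWithin_le_nhds
      |>.eventually_lt_const hδ
  filter_upwards [hsmall, Ioc_mem_nhdsGT hε₁.1] with ε hεδ hε
  have hεI : ε ∈ Icc 0 ε₀ := ⟨hε.1.le, hε.2.trans hε₁.2⟩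
  have hε0 : ε ≠ 0 := hε.1.ne'
  have hh : IsCaratheodoryOn (fun s x => ε • f s x ε) (fun s => ε * g s) T
      (closedBall z₀ (2 * δ)) :=
    { continuousOn := by
        filter_upwards [hcont] with t ht
        exact (ht.comp (continuousOn_id.prodMk continuousOn_const)
          fun x hx => ⟨hx, hεI⟩).const_smul ε
      aestronglyMeasurable := fun x hx => (hmeas x hx ε hεI).const_smul ε
      norm_le := by
        filter_upwards [hbound] with t ht x hx
        rw [norm_smul, Real.norm_eq_abs, abs_of_pos hε.1]
        exact mul_le_mul_of_nonneg_left (ht x hx ε hεI) hε.1.le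
      integrableOn := hg.const_mul ε }
  have hG : ∫ s in (0 : ℝ)..T, ε * g s = ε * ∫ s in (0 : ℝ)..T, g s :=
    intervalIntegral.integral_const_mul _ _
  obtain ⟨x, hxK, hxm, hx, hx0⟩ := hh.exists_periodic_solution hT hδ (hG.trans_le hεδ.le)
    (L := ε⁻¹ • L) (fun a b hab => hL (smul_right_injective E (inv_ne_zero hε0) hab))
    (fun z hz y hy hm hyz => by
      have hm' : AEStronglyMeasurable (fun s => f s (y s) ε) (volume.restrict (Icc 0 T)) := by
        simpa only [Pi.smul_def, inv_smul_smul₀ hε0] using hm.const_smul ε⁻¹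
      have hz' : z ∈ closedBall z₀ (2 * δ) := closedBall_subset_closedBall (by linarith) hz
      have h1 := hclose ε ⟨hε.1.le, hε.2⟩ z hz' y hy hm'
        (fun s hs => (hyz s hs).trans_eq hG)
      have h2 : (ε⁻¹ • L) (∫ s in (0 : ℝ)..T, ε • f s (y s) ε) =
          L (∫ s in (0 : ℝ)..T, f s (y s) ε) := by
        rw [intervalIntegral.integral_smul]
        simp [smul_smul, hε0]
      have h3 : ‖L (∫ s in (0 : ℝ)..T, f s (y s) ε) - L (∫ s in (0 : ℝ)..T, f s z 0)‖ ≤ δ / 2 := by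
        rw [← map_sub]
        calc _ ≤ ‖L‖ * (δ / 2 / (‖L‖ + 1)) := L.le_opNorm_of_le h1
          _ ≤ (‖L‖ + 1) * (δ / 2 / (‖L‖ + 1)) := by gcongr; linarith
          _ = δ / 2 := mul_div_cancel₀ _ (by positivity)
      rw [h2, ← sub_add_sub_cancel _ (L (∫ s in (0 : ℝ)..T, f s z 0))]
      exact (norm_add_le_of_le h3 (hLf z hz)).trans_eq (add_halves δ))
  obtain ⟨φ, hφ, hφx⟩ := exists_isPeriodicSolution_extension
    (h := fun s x => ε • f s x ε) hT (fun t x => by rw [hper]) (hh.integrableOn_comp hxK hxm) hx hx0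
  refine ⟨φ, hφ, fun t => ?_⟩
  obtain ⟨s, hs, hst⟩ := hφx t
  exact hst ▸ hxK s hs

end Existence

/-- Averaging theorem with a nondegenerate zero: if `f` satisfies A.1–A.3 and is
`T`-periodic in `t`, `V` is open and bounded with `closure V ⊆ D`, and `z* ∈ V` is the
unique zero of the averaged function `f₁` in `closure V`, with `f₁` differentiable near
`z*` and `det(Df₁(z*)) ≠ 0`, then there exists `ε_V ∈ (0,ε₀]` such that for every
`ε ∈ [0,ε_V]` the equation `x′ = ε f(t,x,ε)` has a `T`-periodic (absolutely continuous)
solution `φ(·,ε)` with values in `V`, and these solutions can be chosen so that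
`φ(·,ε) → z*` uniformly as `ε → 0`. -/
theorem averaging_nondegenerate_zero
    {n : ℕ} (hn : 1 ≤ n)
    (D : Set (EuclideanSpace ℝ (Fin n))) (hD : IsOpen D)
    (T ε₀ : ℝ) (hT : 0 < T) (hε₀ : 0 < ε₀)
    (f : ℝ → EuclideanSpace ℝ (Fin n) → ℝ → EuclideanSpace ℝ (Fin n))
    (hper : ∀ t x ε, f (t + T) x ε = f t x ε)
    (hA1 : ∀ᵐ t ∂(volume.restrict (Icc (0:ℝ) T)),
      ContinuousOn (fun p : EuclideanSpace ℝ (Fin n) × ℝ => f t p.1 p.2)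
        (D ×ˢ Icc (0:ℝ) ε₀))
    (hA2 : ∀ x ∈ D, ∀ ε ∈ Icc (0:ℝ) ε₀,
      AEStronglyMeasurable (fun t => f t x ε) (volume.restrict (Icc (0:ℝ) T)))
    (hA3 : ∀ r > (0:ℝ), ∃ g : ℝ → ℝ, IntegrableOn g (Icc (0:ℝ) T) ∧
      ∀ᵐ t ∂(volume.restrict (Icc (0:ℝ) T)),
        ∀ x ∈ D, ∀ ε ∈ Icc (0:ℝ) ε₀, ‖(x, ε)‖ ≤ r → ‖f t x ε‖ ≤ g t)
    (V : Set (EuclideanSpace ℝ (Fin n))) (hV : IsOpen V)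
    (hVbd : Bornology.IsBounded V) (hVD : closure V ⊆ D)
    (f₁ : EuclideanSpace ℝ (Fin n) → EuclideanSpace ℝ (Fin n))
    (hf₁ : ∀ z, f₁ z = (1 / T) • ∫ t in (0:ℝ)..T, f t z 0)
    (zstar : EuclideanSpace ℝ (Fin n)) (hzstar_mem : zstar ∈ V)
    (hzstar_zero : f₁ zstar = 0)
    (hzstar_unique : ∀ z ∈ closure V, z ≠ zstar → f₁ z ≠ 0)
    (hdiff : ∃ U : Set (EuclideanSpace ℝ (Fin n)),
      IsOpen U ∧ zstar ∈ U ∧ DifferentiableOn ℝ f₁ U)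
    (hdet : (fderiv ℝ f₁ zstar).det ≠ 0) :
    ∃ εV : ℝ, 0 < εV ∧ εV ≤ ε₀ ∧
      ∃ φ : ℝ → ℝ → EuclideanSpace ℝ (Fin n),
        (∀ ε ∈ Icc (0:ℝ) εV,
          (∀ t, φ ε (t + T) = φ ε t) ∧
          (∀ u v : ℝ, IntervalIntegrable (fun s => ε • f s (φ ε s) ε) volume u v) ∧
          (∀ u v : ℝ, φ ε v - φ ε u = ∫ s in u..v, ε • f s (φ ε s) ε) ∧
          (∀ t ∈ Icc (0:ℝ) T, φ ε t ∈ V)) ∧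
        TendstoUniformlyOn (fun ε t => φ ε t) (fun _ => zstar)
          (nhdsWithin 0 (Icc (0:ℝ) εV)) (Icc (0:ℝ) T) := by
  obtain ⟨U, hU, hzU, hdU⟩ := hdiff
  let A : EuclideanSpace ℝ (Fin n) ≃L[ℝ] EuclideanSpace ℝ (Fin n) :=
    (fderiv ℝ f₁ zstar).toContinuousLinearEquivOfDetNeZero hdet
  have hA : HasFDerivAt f₁ (A : EuclideanSpace ℝ (Fin n) →L[ℝ] EuclideanSpace ℝ (Fin n)) zstar :=
    (hdU.differentiableAt (hU.mem_nhds hzU)).hasFDerivAt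
  obtain ⟨δ, hδ, hδsub⟩ := Metric.nhds_basis_closedBall.mem_iff.1
    ((hA.eventually_norm_symm_sub_le hzstar_zero).and (hV.mem_nhds hzstar_mem))
  have hδV : closedBall zstar δ ⊆ V := fun z hz => (hδsub hz).2
  have hδD : closedBall zstar δ ⊆ D := hδV.trans (subset_closure.trans hVD)
  obtain ⟨g, hg, hgf⟩ := hA3 (max (‖zstar‖ + δ) ε₀) (lt_max_of_lt_right hε₀)
  have hbound : ∀ᵐ t ∂(volume.restrict (Icc (0 : ℝ) T)),
      ∀ x ∈ closedBall zstar δ, ∀ ε ∈ Icc (0 : ℝ) ε₀, ‖f t x ε‖ ≤ g t := by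
    filter_upwards [hgf] with t ht x hx ε hε
    refine ht x (hδD hx) ε hε (max_le_max ?_ ?_)
    · exact norm_le_of_mem_closedBall hx
    · exact (abs_of_nonneg hε.1).trans_le hε.2
  have hex : ∀ k : ℕ, ∀ᶠ ε in 𝓝[>] (0 : ℝ), ∃ φ,
      IsPeriodicSolution (fun s x => ε • f s x ε) T φ ∧
        ∀ t, φ t ∈ closedBall zstar (δ / (k + 1)) := by
    intro k
    have hρ : δ / (k + 1) ≤ δ := div_le_self hδ.le (by simp)
    have hsub := closedBall_subset_closedBall (x := zstar) hρ
    have hρ2 : 2 * (δ / (k + 1) / 2) = δ / (k + 1) := mul_div_cancel₀ _ two_ne_zero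
    have hpos : 0 < δ / (k + 1) / 2 := by positivity
    rw [← hρ2] at hsub ⊢
    refine eventually_exists_isPeriodicSolution (g := g)
      (L := (1 / T) • (A.symm : EuclideanSpace ℝ (Fin n) →L[ℝ] EuclideanSpace ℝ (Fin n)))
      hT hε₀ hpos hper ?_
      (fun x hx ε hε => hA2 x (hδD (hsub hx)) ε hε) ?_ hg
      (fun a b hab => A.symm.injective (smul_right_injective _ (one_div_ne_zero hT.ne') hab)) ?_
    · filter_upwards [hA1] with t ht
      exact ht.mono (prod_mono (hsub.trans hδD) le_rfl)
    · filter_upwards [hbound] with t ht x hx using ht x (hsub hx)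
    · intro z hz
      have hzδ := (hδsub (hsub (closedBall_subset_closedBall (by linarith) hz))).1
      rw [hf₁, map_smul] at hzδ
      refine hzδ.trans (div_le_div_of_nonneg_right (mem_closedBall_iff_norm.1 hz) zero_le_two)
  obtain ⟨φ, hφ⟩ := exists_forall_eventually_of_antitone
    (tendsto_nat_floor_atTop.comp tendsto_inv_nhdsGT_zero)
    (fun ε φ k m hkm hm => ⟨hm.1, fun t => closedBall_subset_closedBall
      (div_le_div_of_nonneg_left hδ.le (by positivity) (by gcongr)) (hm.2 t)⟩) hex
  obtain ⟨ε₁, hε₁, hsol⟩ := mem_nhdsGT_iff_exists_Ioc_subset.1 (hφ 0)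
  refine ⟨min ε₁ ε₀, lt_min hε₁ hε₀, min_le_right _ _,
    fun ε => if ε = 0 then fun _ => zstar else φ ε, fun ε hε => ?_, ?_⟩
  · by_cases h0 : ε = 0
    · simp [h0, hzstar_mem]
    · have hs := hsol ⟨hε.1.lt_of_ne' h0, hε.2.trans (min_le_left _ _)⟩
      simp only [h0, if_false]
      refine ⟨hs.1.periodic, hs.1.intervalIntegrable, hs.1.sub_eq_integral,
        fun t _ => hδV (by simpa using hs.2 t)⟩
  · rw [Metric.tendstoUniformlyOn_iff]
    intro η hη
    obtain ⟨k, hk⟩ := exists_nat_gt (δ / η)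
    have hkη : δ / (k + 1) < η := by
      rw [div_lt_iff₀ (by positivity)]
      rw [div_lt_iff₀ hη] at hk
      nlinarith
    filter_upwards [self_mem_nhdsWithin, nhdsWithin_le_nhds
      (eventually_nhdsWithin_iff.1 (hφ k))] with ε hε hεk t _
    by_cases h0 : ε = 0
    · simpa [h0] using hη
    · simp only [h0, if_false]
      rw [dist_comm]
      exact ((hεk (hε.1.lt_of_ne' h0)).2 t).trans_lt hkη
end
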